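/- Let Q = ℝⁿ × (0,∞), let L be a nondivergence parabolic operator on Q with ellipticity constant ν, and let (ω^X) be the L-caloric measure for Q. Then for every K ≥ 1 and R > 0 there exists N = N(n, ν, K, R) such that ω^X(B₁(0) × {0}) ≥ 1/N for every X = (x,t) ∈ U_R = {(x,t) : t > 0, |x| ≤ K√t ≤ KR}. -/

import Mathlib

open MeasureTheory Set Metric Filter

noncomputable section

/-- Euclidean space `ℝⁿ`. -/
abbrev E (n : ℕ) : Type := EuclideanSpace ℝ (Fin n)

/-- Second spatial partial derivative `D_i D_j u` at a space-time point `X`. -/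
def D2 {n : ℕ} (u : E n × ℝ → ℝ) (X : E n × ℝ) (i j : Fin n) : ℝ :=
  fderiv ℝ (fun x => fderiv ℝ (fun x' => u (x', X.2)) x (EuclideanSpace.single j 1))
    X.1 (EuclideanSpace.single i 1)

/-- Time derivative `D_t u` at a space-time point `X`. -/
def Dt {n : ℕ} (u : E n × ℝ → ℝ) (X : E n × ℝ) : ℝ :=
  deriv (fun t => u (X.1, t)) X.2

/-- The value `Lu(X)` of the nondivergence parabolic operator with coefficients `a`. -/
def LVal {n : ℕ} (a : E n × ℝ → Fin n → Fin n → ℝ) (u : E n × ℝ → ℝ) (X : E n × ℝ) : ℝ :=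
  (∑ i, ∑ j, a X i j * D2 u X i j) - Dt u X

/-- `u` is C² in `x` and C¹ in `t` at every point of `V`. -/
def ParabolicSmoothOn {n : ℕ} (u : E n × ℝ → ℝ) (V : Set (E n × ℝ)) : Prop :=
  ∀ X ∈ V, ContDiffAt ℝ 2 (fun x => u (x, X.2)) X.1 ∧
    DifferentiableAt ℝ (fun t => u (X.1, t)) X.2

/-- `u` solves `Lu = 0` pointwise in `V` (being C² in `x`, C¹ in `t` there). -/
def SolvesL {n : ℕ} (a : E n × ℝ → Fin n → Fin n → ℝ) (u : E n × ℝ → ℝ)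
    (V : Set (E n × ℝ)) : Prop :=
  ParabolicSmoothOn u V ∧ ∀ X ∈ V, LVal a u X = 0

/-- `a` is a smooth coefficient matrix on `S`, uniformly elliptic with constant `ν`
and with entries bounded by `ν⁻¹`. -/
def IsParabolicCoeff {n : ℕ} (ν : ℝ) (a : E n × ℝ → Fin n → Fin n → ℝ)
    (S : Set (E n × ℝ)) : Prop :=
  (∀ i j, ContDiffOn ℝ (⊤ : ℕ∞) (fun X => a X i j) S) ∧
  ∀ X ∈ S, (∀ ξ : Fin n → ℝ, ν * ∑ i, ξ i ^ 2 ≤ ∑ i, ∑ j, a X i j * ξ i * ξ j) ∧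
    ∀ i j, |a X i j| ≤ ν⁻¹

/-- The cylinder `Ω × (t₀, ∞)`. -/
def CylFrom {n : ℕ} (Ω : Set (E n)) (t₀ : ℝ) : Set (E n × ℝ) := Ω ×ˢ Ioi t₀

/-- The cylinder `Q = Ω × (0, ∞)`. -/
def Cyl {n : ℕ} (Ω : Set (E n)) : Set (E n × ℝ) := CylFrom Ω 0

/-- Parabolic boundary of the cylinder `Ω × (t₀, ∞)`:
`(∂Ω × (t₀,∞)) ∪ (cl(Ω) × {t₀})`. -/
def pBFrom {n : ℕ} (Ω : Set (E n)) (t₀ : ℝ) : Set (E n × ℝ) :=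
  (frontier Ω ×ˢ Ioi t₀) ∪ (closure Ω ×ˢ {t₀})

/-- Parabolic boundary of `Ω × (0, ∞)`. -/
def pB {n : ℕ} (Ω : Set (E n)) : Set (E n × ℝ) := pBFrom Ω 0

/-- The cylinder `C_{R,r}(Y) = B_R(y) × (s - r², s + r²)`. -/
def CRr {n : ℕ} (Y : E n × ℝ) (R r : ℝ) : Set (E n × ℝ) :=
  ball Y.1 R ×ˢ Ioo (Y.2 - r ^ 2) (Y.2 + r ^ 2)

/-- The standard cylinder `C_r(Y) = B_r(y) × (s - r², s + r²)`. -/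
def Cr {n : ℕ} (Y : E n × ℝ) (r : ℝ) : Set (E n × ℝ) := CRr Y r r

/-- `ω` is the `L`-caloric measure family for the cylinder `Ω × (t₀, ∞)`:
each `ω X` is a Borel probability measure on the parabolic boundary, and for every
bounded continuous `φ`, `X ↦ ∫ φ dω^X` is a (bounded) solution of `Lu = 0` in the
cylinder extending continuously to `φ` at each point of the parabolic boundary. -/
def IsCaloricMeasureFrom {n : ℕ} (a : E n × ℝ → Fin n → Fin n → ℝ) (Ω : Set (E n))
    (t₀ : ℝ) (ω : E n × ℝ → Measure (E n × ℝ)) : Prop :=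
  (∀ X ∈ CylFrom Ω t₀, IsProbabilityMeasure (ω X) ∧ ω X (pBFrom Ω t₀)ᶜ = 0) ∧
  ∀ φ : E n × ℝ → ℝ, Continuous φ → (∃ M, ∀ z, |φ z| ≤ M) →
    SolvesL a (fun X => ∫ z, φ z ∂ω X) (CylFrom Ω t₀) ∧
    ∀ Z ∈ pBFrom Ω t₀, Tendsto (fun X => ∫ z, φ z ∂ω X)
      (nhdsWithin Z (CylFrom Ω t₀)) (nhds (φ Z))

/-- `ω` is the `L`-caloric measure family for `Q = Ω × (0, ∞)`. -/
def IsCaloricMeasure {n : ℕ} (a : E n × ℝ → Fin n → Fin n → ℝ) (Ω : Set (E n))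
    (ω : E n × ℝ → Measure (E n × ℝ)) : Prop :=
  IsCaloricMeasureFrom a Ω 0 ω

/-- `Ω` is a Lipschitz domain with constants `m, r₀ > 0`: it is a nonempty open
connected set and near each boundary point, in a suitable orthonormal coordinate
system centered at that point, it coincides with the region above the graph of a
function with `‖∇φ‖_{L^∞} ≤ m` (equivalently, `m`-Lipschitz). -/
def IsLipschitzDomain {n : ℕ} (hn : 0 < n) (Ω : Set (E n)) (m r₀ : ℝ) : Prop :=
  IsOpen Ω ∧ Ω.Nonempty ∧ IsConnected Ω ∧ 0 < m ∧ 0 < r₀ ∧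
  ∀ y ∈ frontier Ω, ∃ (T : E n ≃ₗᵢ[ℝ] E n) (φ : E (n - 1) → ℝ),
    LipschitzWith m.toNNReal φ ∧
    ∀ x : E n, x ∈ Ω ∩ ball y r₀ ↔
      ‖x - y‖ < r₀ ∧
        φ ((EuclideanSpace.equiv (Fin (n - 1)) ℝ).symm
            (fun i => T (x - y) (Fin.castLE (Nat.sub_le n 1) i))) <
          T (x - y) ⟨n - 1, Nat.sub_lt hn Nat.one_pos⟩

/-- The set `Ω^δ = {x ∈ Ω : dist(x, ∂Ω) > δ}`. -/
def innerSet {n : ℕ} (Ω : Set (E n)) (δ : ℝ) : Set (E n) :=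
  {x ∈ Ω | δ < infDist x (frontier Ω)}

/-- The corkscrew property (2.3) with constant `μ`. -/
def Corkscrew {n : ℕ} (Ω : Set (E n)) (r₀ μ : ℝ) : Prop :=
  ∀ y ∈ frontier Ω, ∀ r : ℝ, 0 < r → r < r₀ →
    (∃ y₁ : E n, ball y₁ (2 * μ * r) ⊆ ball y r ∩ Ω) ∧
    (∃ y₂ : E n, ball y₂ (2 * μ * r) ⊆ ball y r \ Ω)

/-- Spatial second partial derivative. -/
def d2 {n : ℕ} (f : E n → ℝ) (x : E n) (i j : Fin n) : ℝ :=
  fderiv ℝ (fun y => fderiv ℝ f y (EuclideanSpace.single j 1)) x (EuclideanSpace.single i 1)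

lemma D2_eq_d2 {n : ℕ} (u : E n × ℝ → ℝ) (x : E n) (t : ℝ) (i j : Fin n) :
    D2 u (x, t) i j = d2 (fun y => u (y, t)) x i j := rfl

lemma hasDerivAt_pp (m : ℕ) (s : ℝ) :
    HasDerivAt (fun r : ℝ => (max r 0) ^ (m + 2)) ((m + 2 : ℝ) * (max s 0) ^ (m + 1)) s := by
  rcases lt_trichotomy s 0 with h | h | h
  · have : (fun r : ℝ => (max r 0) ^ (m + 2)) =ᶠ[nhds s] fun _ => 0 := by
      filter_upwards [Iio_mem_nhds h] with r hr
      simp [max_eq_right (mem_Iio.mp hr).le]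
    rw [max_eq_right h.le]
    simpa using (hasDerivAt_const s (0 : ℝ)).congr_of_eventuallyEq this
  · subst h
    rw [hasDerivAt_iff_isLittleO_nhds_zero]
    simp only [max_self, zero_add]
    have h1 : (fun h : ℝ => h ^ (m + 2)) =o[nhds 0] fun h : ℝ => h := by
      have := Asymptotics.isLittleO_pow_id (𝕜 := ℝ) (n := m + 2) (by omega)
      simpa using this
    refine Asymptotics.IsBigO.trans_isLittleO ?_ h1
    refine Asymptotics.IsBigO.of_bound 1 (Eventually.of_forall fun r => ?_)
    simp only [ne_eq, Nat.add_eq_zero_iff, one_ne_zero, and_false, not_false_eq_true, zero_pow,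
      mul_zero, smul_zero, sub_zero, norm_pow, one_mul, OfNat.ofNat_ne_zero]
    refine pow_le_pow_left₀ (norm_nonneg _) ?_ _
    rw [Real.norm_eq_abs, Real.norm_eq_abs, abs_of_nonneg (le_max_right _ _)]
    exact max_le (le_abs_self _) (abs_nonneg _)
  · have : (fun r : ℝ => (max r 0) ^ (m + 2)) =ᶠ[nhds s] fun r => r ^ (m + 2) := by
      filter_upwards [Ioi_mem_nhds h] with r hr
      simp [max_eq_left (mem_Ioi.mp hr).le]
    rw [max_eq_left h.le]
    have := (hasDerivAt_pow (m + 2) s).congr_of_eventuallyEq this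
    simpa using this

lemma hasDerivAt_G (s : ℝ) :
    HasDerivAt (fun r : ℝ => (max r 0) ^ 3) (3 * (max s 0) ^ 2) s := by
  have := hasDerivAt_pp 1 s
  norm_num at this
  exact this

lemma hasDerivAt_G' (s : ℝ) :
    HasDerivAt (fun r : ℝ => 3 * (max r 0) ^ 2) (6 * max s 0) s := by
  have := (hasDerivAt_pp 0 s).const_mul 3
  norm_num at this
  rwa [show (6 : ℝ) * max s 0 = 3 * (2 * max s 0) by ring]

lemma contDiff_G : ContDiff ℝ 2 (fun r : ℝ => (max r 0) ^ 3) := by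
  have h2 : deriv (fun r : ℝ => (max r 0) ^ 3) = fun s => 3 * (max s 0) ^ 2 :=
    funext fun s => (hasDerivAt_G s).deriv
  have h3 : deriv (fun r : ℝ => 3 * (max r 0) ^ 2) = fun s => 6 * (max s 0) :=
    funext fun s => (hasDerivAt_G' s).deriv
  have h1 : ContDiff ℝ 1 (fun r : ℝ => 3 * (max r 0) ^ 2) := by
    rw [contDiff_one_iff_deriv, h3]
    exact ⟨fun s => (hasDerivAt_G' s).differentiableAt, by fun_prop⟩
  rw [show (2 : WithTop ℕ∞) = 1 + 1 by norm_num, contDiff_succ_iff_deriv, h2]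
  exact ⟨fun s => (hasDerivAt_G s).differentiableAt, by simp, h1⟩

lemma contDiff_pd {n : ℕ} {f : E n → ℝ} (hf : ContDiff ℝ 2 f) (v : E n) :
    ContDiff ℝ 1 (fun y => fderiv ℝ f y v) :=
  (hf.fderiv_right (m := 1) (by norm_num)).clm_apply contDiff_const

lemma continuous_d2 {n : ℕ} {f : E n → ℝ} (hf : ContDiff ℝ 2 f) (i j : Fin n) :
    Continuous (fun x => d2 f x i j) :=
  ((contDiff_pd hf _).continuous_fderiv (by norm_num)).clm_apply continuous_const

lemma d2_sub {n : ℕ} {f g : E n → ℝ} (hf : ContDiff ℝ 2 f) (hg : ContDiff ℝ 2 g)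
    (x : E n) (i j : Fin n) : d2 (fun y => f y - g y) x i j = d2 f x i j - d2 g x i j := by
  unfold d2
  have h1 : (fun y => fderiv ℝ (fun y => f y - g y) y (EuclideanSpace.single j 1)) =
      fun y => fderiv ℝ f y (EuclideanSpace.single j 1) -
        fderiv ℝ g y (EuclideanSpace.single j 1) := by
    funext y
    rw [fderiv_fun_sub (hf.differentiable (by norm_num) y) (hg.differentiable (by norm_num) y)]
    rfl
  rw [h1, fderiv_fun_sub ((contDiff_pd hf _).differentiable (by norm_num) x)
    ((contDiff_pd hg _).differentiable (by norm_num) x)]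
  rfl

lemma d2_G {n : ℕ} {q : E n → ℝ} (hq : ContDiff ℝ 2 q) (x : E n) (i j : Fin n) :
    d2 (fun y => (max (q y) 0) ^ 3) x i j = 3 * (max (q x) 0) ^ 2 * d2 q x i j +
      6 * max (q x) 0 * (fderiv ℝ q x (EuclideanSpace.single i 1) *
        fderiv ℝ q x (EuclideanSpace.single j 1)) := by
  unfold d2
  have h1 : (fun y => fderiv ℝ (fun y => (max (q y) 0) ^ 3) y (EuclideanSpace.single j 1)) =
      fun y => (3 * (max (q y) 0) ^ 2) * fderiv ℝ q y (EuclideanSpace.single j 1) := by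
    funext y
    have := ((hasDerivAt_G (q y)).comp_hasFDerivAt y
      (hq.differentiable (by norm_num) y).hasFDerivAt).fderiv
    simp only [Function.comp_def] at this
    rw [this]; rfl
  rw [h1]
  have h2 := (hasDerivAt_G' (q x)).comp_hasFDerivAt x
      (hq.differentiable (by norm_num) x).hasFDerivAt
  have h3 := h2.mul ((contDiff_pd hq (EuclideanSpace.single j 1)).differentiable
    (by norm_num) x).hasFDerivAt
  have h4 := h3.fderiv
  simp only [Function.comp_def] at h4
  erw [h4]
  simp
  ring

lemma ibp1 {n : ℕ} {A g : E n → ℝ} (hA : ContDiff ℝ 1 A) (hg : ContDiff ℝ 1 g)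
    (hc : HasCompactSupport g) (v : E n) :
    ∫ x, A x * fderiv ℝ g x v = - ∫ x, fderiv ℝ A x v * g x := by
  have c1 : Continuous (fun x => fderiv ℝ A x v) :=
    (hA.continuous_fderiv (by norm_num)).clm_apply continuous_const
  have c2 : Continuous (fun x => fderiv ℝ g x v) :=
    (hg.continuous_fderiv (by norm_num)).clm_apply continuous_const
  have hc' : HasCompactSupport (fun x => fderiv ℝ g x v) := hc.fderiv_apply (𝕜 := ℝ) v
  refine integral_mul_fderiv_eq_neg_fderiv_mul_of_integrable ?_ ?_ ?_ ?_ ?_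
  · exact (c1.mul hg.continuous).integrable_of_hasCompactSupport hc.mul_left
  · exact (hA.continuous.mul c2).integrable_of_hasCompactSupport hc'.mul_left
  · exact (hA.continuous.mul hg.continuous).integrable_of_hasCompactSupport hc.mul_left
  · exact fun x _ => hA.differentiable (by norm_num) x
  · exact fun x _ => hg.differentiable (by norm_num) x

lemma ibp2 {n : ℕ} {A g : E n → ℝ} (hA : ContDiff ℝ 2 A) (hg : ContDiff ℝ 2 g)
    (hc : HasCompactSupport g) (i j : Fin n) :
    ∫ x, A x * d2 g x i j = ∫ x, d2 A x j i * g x := by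
  have hc' : HasCompactSupport (fun x => fderiv ℝ g x (EuclideanSpace.single j 1)) :=
    hc.fderiv_apply (𝕜 := ℝ) _
  unfold d2
  rw [ibp1 (hA.of_le (by norm_num)) (contDiff_pd hg _) hc',
    ibp1 (contDiff_pd hA _) (hg.of_le (by norm_num)) hc, neg_neg]

open scoped MatrixOrder Matrix.Norms.L2Operator in
lemma trace_nonneg {n : ℕ} {a N : Fin n → Fin n → ℝ}
    (ha : ∀ ξ : Fin n → ℝ, 0 ≤ ∑ i, ∑ j, a i j * ξ i * ξ j)
    (hs : ∀ i j, N i j = N j i)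
    (hN : ∀ ξ : Fin n → ℝ, 0 ≤ ∑ i, ∑ j, N i j * ξ i * ξ j) :
    0 ≤ ∑ i, ∑ j, a i j * N i j := by
  have hP : Matrix.PosSemidef (Matrix.of N) := by
    refine Matrix.PosSemidef.of_dotProduct_mulVec_nonneg ?_ ?_
    · exact Matrix.IsHermitian.ext fun i j => by simpa using hs j i
    · intro ξ
      refine (hN ξ).trans_eq ?_
      simp only [dotProduct, Matrix.mulVec, Finset.mul_sum, Matrix.of_apply, star_trivial,
        Pi.star_apply]
      exact Finset.sum_congr rfl fun i _ => Finset.sum_congr rfl fun j _ => by ring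
  obtain ⟨B, hB⟩ := (CStarAlgebra.nonneg_iff_eq_star_mul_self (a := Matrix.of N)).mp
    (by exact hP.nonneg)
  have hB' : ∀ i j, N i j = ∑ k, B k i * B k j := by
    intro i j
    have := congrFun (congrFun hB i) j
    simpa [Matrix.mul_apply, Matrix.star_apply] using this
  have : ∑ i, ∑ j, a i j * N i j = ∑ k, ∑ i, ∑ j, a i j * B k i * B k j := by
    simp only [hB', Finset.mul_sum]
    rw [Finset.sum_comm (s := (Finset.univ : Finset (Fin n)))
      (f := fun k i => ∑ j, a i j * B k i * B k j)]
    refine Finset.sum_congr rfl fun i _ => ?_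
    rw [Finset.sum_comm]
    exact Finset.sum_congr rfl fun k _ => Finset.sum_congr rfl fun j _ => by ring
  rw [this]
  exact Finset.sum_nonneg fun k _ => ha _

/-- Standing assumptions: `U` is a (separately regular) solution on `t > 0` with bounded
nonpositive values, and `Ca` bounds the formal adjoint zeroth order coefficient. -/
structure Ctx {n : ℕ} (a : E n × ℝ → Fin n → Fin n → ℝ) (U : E n × ℝ → ℝ)
    (Λ M τ T R Ca : ℝ) : Prop where
  hτ : 0 < τ
  hM : ∀ x t, 0 < t → -M ≤ U (x, t)
  hU0 : ∀ x t, 0 < t → U (x, t) ≤ 0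
  hx : ∀ t, 0 < t → ContDiff ℝ 2 (fun x => U (x, t))
  ht : ∀ x t, 0 < t → DifferentiableAt ℝ (fun s => U (x, s)) t
  hL : ∀ x t, 0 < t → LVal a U (x, t) = 0
  ha2 : ∀ t, 0 < t → ∀ i j, ContDiff ℝ 2 (fun x => a (x, t) i j)
  hpsd : ∀ x t, 0 < t → ∀ ξ : Fin n → ℝ, 0 ≤ ∑ i, ∑ j, a (x, t) i j * ξ i * ξ j
  hΛ : ∀ x t, 0 < t → ∀ i j, |a (x, t) i j| ≤ Λ
  hCa : ∀ t ∈ Icc τ T, ∀ x, ‖x‖ ≤ R → ∑ i, ∑ j, d2 (fun y => a (y, t) i j) x j i ≤ Ca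

/-- Admissible comparison functions. -/
def Adm {n : ℕ} (a : E n × ℝ → Fin n → Fin n → ℝ) (T R α : ℝ) (w : E n × ℝ → ℝ) : Prop :=
  ContDiff ℝ 2 w ∧ ∃ R' < R, ∀ t ∈ Icc α T, ∀ x, w (x, t) ≤ 0 → ‖x‖ ≤ R' ∧ LVal a w (x, t) ≤ 0

def JJ {n : ℕ} (U w : E n × ℝ → ℝ) (t : ℝ) : ℝ := ∫ x : E n, (max (U (x, t) - w (x, t)) 0) ^ 3

def Ph {n : ℕ} (Ca : ℝ) (U w : E n × ℝ → ℝ) (t : ℝ) : ℝ := Real.exp (-(Ca * t)) * JJ U w t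

section
variable {n : ℕ} {a : E n × ℝ → Fin n → Fin n → ℝ} {U w : E n × ℝ → ℝ} {Λ M τ T R Ca α : ℝ}

lemma Adm.mono {β : ℝ} (h : Adm a T R α w) (hab : α ≤ β) : Adm a T R β w := by
  obtain ⟨h1, R', hR', h2⟩ := h
  exact ⟨h1, R', hR', fun t ht => h2 t ⟨hab.trans ht.1, ht.2⟩⟩

lemma Ctx.q_zero (H : Ctx a U Λ M τ T R Ca) (hα : τ ≤ α) (hw : Adm a T R α w)
    {t : ℝ} (ht : t ∈ Icc α T) {x : E n} (hx : R ≤ ‖x‖) : max (U (x, t) - w (x, t)) 0 = 0 := by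
  obtain ⟨h1, R', hR', h2⟩ := hw
  apply max_eq_right
  by_contra hc
  push Not at hc
  have ht0 : 0 < t := H.hτ.trans_le (hα.trans ht.1)
  have := (h2 t ht x (by linarith [H.hU0 x t ht0])).1
  linarith

lemma Ctx.w_lt (H : Ctx a U Λ M τ T R Ca) (hα : τ ≤ α)
    {t : ℝ} (ht : α ≤ t) {x : E n} (hq : 0 < max (U (x, t) - w (x, t)) 0) : w (x, t) ≤ 0 := by
  have ht0 : 0 < t := H.hτ.trans_le (hα.trans ht)
  have : 0 < U (x, t) - w (x, t) := by
    by_contra hc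
    rw [max_eq_right (not_lt.mp hc)] at hq
    exact lt_irrefl _ hq
  linarith [H.hU0 x t ht0]

lemma exists_bound_w (hw : Continuous w) (R s t : ℝ) :
    ∃ C, 0 ≤ C ∧ ∀ x : E n, ‖x‖ ≤ R → ∀ r ∈ Icc s t, |w (x, r)| ≤ C := by
  have hc : IsCompact ((closedBall (0 : E n) R) ×ˢ Icc s t) :=
    (isCompact_closedBall _ _).prod isCompact_Icc
  obtain ⟨C, hC⟩ := hc.exists_bound_of_continuousOn hw.continuousOn
  refine ⟨max C 0, le_max_right _ _, fun x hx r hr => le_max_of_le_left ?_⟩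
  exact hC (x, r) ⟨by simpa using hx, hr⟩

lemma Ctx.q_bound (H : Ctx a U Λ M τ T R Ca) (hα : τ ≤ α) (hw : Adm a T R α w) :
    ∃ C, 0 ≤ C ∧ ∀ t ∈ Icc α T, ∀ x, max (U (x, t) - w (x, t)) 0 ≤ C := by
  obtain ⟨C, hC0, hC⟩ := exists_bound_w hw.1.continuous R α T
  refine ⟨C, hC0, fun t ht x => ?_⟩
  rcases le_total R ‖x‖ with hx | hx
  · rw [H.q_zero hα hw ht hx]; exact hC0
  · refine max_le ?_ hC0
    have := abs_le.mp (hC x hx t ht)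
    linarith [H.hU0 x t (H.hτ.trans_le (hα.trans ht.1))]

lemma Ctx.cdq (H : Ctx a U Λ M τ T R Ca) (hα : τ ≤ α) (hw : Adm a T R α w)
    {t : ℝ} (ht : α ≤ t) : ContDiff ℝ 2 (fun x => U (x, t) - w (x, t)) :=
  (H.hx t (H.hτ.trans_le (hα.trans ht))).sub
    (hw.1.comp (contDiff_id.prodMk contDiff_const))

lemma Ctx.compact_supp (H : Ctx a U Λ M τ T R Ca) (hα : τ ≤ α) (hw : Adm a T R α w)
    {t : ℝ} (ht : t ∈ Icc α T) : 
    HasCompactSupport (fun x => max (U (x, t) - w (x, t)) 0) := by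
  refine HasCompactSupport.intro (isCompact_closedBall (0 : E n) R) fun x hx => ?_
  refine H.q_zero hα hw ht ?_
  simp only [mem_closedBall, dist_zero_right, not_le] at hx
  exact hx.le

lemma Ctx.J_cont (H : Ctx a U Λ M τ T R Ca) (hα : τ ≤ α) (hw : Adm a T R α w) :
    ContinuousOn (JJ U w) (Icc α T) := by
  obtain ⟨C, hC0, hC⟩ := H.q_bound hα hw
  unfold JJ
  refine continuousOn_of_dominated (bound := (closedBall (0 : E n) R).indicator fun _ => C ^ 3)
    ?_ ?_ ?_ ?_
  · intro t ht
    exact (((H.cdq hα hw ht.1).continuous.max continuous_const).pow 3).aestronglyMeasurable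
  · intro t ht
    refine Eventually.of_forall fun x => ?_
    have h0 : 0 ≤ max (U (x, t) - w (x, t)) 0 := le_max_right _ _
    rw [Real.norm_of_nonneg (pow_nonneg h0 3)]
    by_cases hx : x ∈ closedBall (0 : E n) R
    · rw [indicator_of_mem hx]
      exact pow_le_pow_left₀ h0 (hC t ht x) 3
    · rw [indicator_of_notMem hx]
      simp only [mem_closedBall, dist_zero_right, not_le] at hx
      rw [H.q_zero hα hw ht hx.le]; norm_num
  · rw [integrable_indicator_iff isClosed_closedBall.measurableSet]
    exact integrableOn_const (isCompact_closedBall _ _).measure_lt_top.ne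
  · refine Eventually.of_forall fun x => ?_
    refine ContinuousOn.pow (ContinuousOn.sup (ContinuousOn.sub ?_ ?_) continuousOn_const) 3
    · exact fun t ht => (H.ht x t (H.hτ.trans_le (hα.trans ht.1))).continuousAt.continuousWithinAt
    · exact (hw.1.continuous.comp (by fun_prop : Continuous fun t : ℝ => (x, t))).continuousOn

lemma Ctx.Ph_cont (H : Ctx a U Λ M τ T R Ca) (hα : τ ≤ α) (hw : Adm a T R α w) :
    ContinuousOn (Ph Ca U w) (Icc α T) :=
  ContinuousOn.mul (by fun_prop) (H.J_cont hα hw)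

lemma JJ_nonneg (t : ℝ) : 0 ≤ JJ U w t :=
  integral_nonneg fun x => pow_nonneg (le_max_right _ _) 3

lemma Ph_nonneg (t : ℝ) : 0 ≤ Ph Ca U w t := mul_nonneg (Real.exp_pos _).le (JJ_nonneg t)

lemma Ctx.J_zero (H : Ctx a U Λ M τ T R Ca) (hα : τ ≤ α) (hw : Adm a T R α w)
    {t : ℝ} (ht : t ∈ Icc α T) (h0 : JJ U w t = 0) (x : E n) : U (x, t) ≤ w (x, t) := by
  by_contra hc
  push Not at hc
  have hcont : Continuous (fun x => (max (U (x, t) - w (x, t)) 0) ^ 3) :=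
    ((H.cdq hα hw ht.1).continuous.max continuous_const).pow 3
  have hs : HasCompactSupport (fun x => (max (U (x, t) - w (x, t)) 0) ^ 3) :=
    (H.compact_supp hα hw ht).comp_left (g := fun r => r ^ 3) (by norm_num)
  have := hcont.integral_pos_of_hasCompactSupport_nonneg_nonzero (μ := volume) hs
    (fun x => pow_nonneg (le_max_right _ _) 3) (x := x)
    (by rw [max_eq_left (by linarith)]; exact pow_ne_zero _ (by linarith))
  exact this.ne' h0

lemma JJ_of_le {t : ℝ} (h : ∀ x, U (x, t) ≤ w (x, t)) : JJ U w t = 0 := by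
  unfold JJ
  have : ∀ x, (max (U (x, t) - w (x, t)) 0) ^ 3 = 0 := fun x => by
    rw [max_eq_right (by linarith [h x])]; norm_num
  simp [this]

lemma Ctx.DtU (H : Ctx a U Λ M τ T R Ca) (x : E n) {t : ℝ} (ht : 0 < t) :
    Dt U (x, t) = ∑ i, ∑ j, a (x, t) i j * d2 (fun y => U (y, t)) x i j := by
  have := H.hL x t ht
  unfold LVal at this
  simp only [D2_eq_d2] at this
  linarith

lemma Ctx.DtU_cont (H : Ctx a U Λ M τ T R Ca) {t : ℝ} (ht : 0 < t) :
    Continuous (fun x => Dt U (x, t)) := by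
  have : (fun x => Dt U (x, t)) =
      fun x => ∑ i, ∑ j, a (x, t) i j * d2 (fun y => U (y, t)) x i j :=
    funext fun x => H.DtU x ht
  rw [this]
  exact continuous_finsetSum _ fun i _ => continuous_finsetSum _ fun j _ =>
    (H.ha2 t ht i j).continuous.mul (continuous_d2 (H.hx t ht) i j)

lemma Dt_eq_fderiv (hw : ContDiff ℝ 2 w) (x : E n) (t : ℝ) :
    HasDerivAt (fun s => w (x, s)) (fderiv ℝ w (x, t) (0, 1)) t := by
  have h1 : HasFDerivAt w (fderiv ℝ w (x, t)) (x, t) :=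
    (hw.differentiable (by norm_num) (x, t)).hasFDerivAt
  have h2 : HasDerivAt (fun s : ℝ => (x, s)) ((0 : E n), (1 : ℝ)) t :=
    (hasDerivAt_const t x).prodMk (hasDerivAt_id t)
  exact h1.comp_hasDerivAt t h2

lemma Dtw_cont (hw : ContDiff ℝ 2 w) : Continuous (fun X : E n × ℝ => Dt w X) := by
  have : (fun X : E n × ℝ => Dt w X) = fun X => fderiv ℝ w X (0, 1) :=
    funext fun X => (Dt_eq_fderiv hw X.1 X.2).deriv
  rw [this]
  exact (hw.continuous_fderiv (by norm_num)).clm_apply continuous_const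

lemma Ctx.J_deriv (H : Ctx a U Λ M τ T R Ca) (hα : τ ≤ α) (hw : Adm a T R α w)
    {t : ℝ} (ht : t ∈ Icc α T) :
    ∫ x : E n, 3 * (max (U (x, t) - w (x, t)) 0) ^ 2 * (Dt U (x, t) - Dt w (x, t)) ≤
      Ca * JJ U w t := by
  have ht0 : 0 < t := H.hτ.trans_le (hα.trans ht.1)
  have hq := H.cdq hα hw ht.1
  have hwt : ContDiff ℝ 2 (fun x => w (x, t)) := hw.1.comp (contDiff_id.prodMk contDiff_const)
  have hs := H.compact_supp hα hw ht
  have hG : ContDiff ℝ 2 (fun x => (max (U (x, t) - w (x, t)) 0) ^ 3) := contDiff_G.comp hq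
  have hsG : HasCompactSupport (fun x => (max (U (x, t) - w (x, t)) 0) ^ 3) :=
    hs.comp_left (g := fun r => r ^ 3) (by norm_num)
  have hs2 : HasCompactSupport (fun x => 3 * (max (U (x, t) - w (x, t)) 0) ^ 2) :=
    hs.comp_left (g := fun r => 3 * r ^ 2) (by norm_num)
  have hsd : ∀ i j, HasCompactSupport
      (fun x => d2 (fun y => (max (U (y, t) - w (y, t)) 0) ^ 3) x i j) := fun i j =>
    (hsG.fderiv_apply (𝕜 := ℝ) _).fderiv_apply (𝕜 := ℝ) _
  have hint : ∀ i j, Integrable (fun x => a (x, t) i j *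
      d2 (fun y => (max (U (y, t) - w (y, t)) 0) ^ 3) x i j) := fun i j =>
    ((H.ha2 t ht0 i j).continuous.mul (continuous_d2 hG i j)).integrable_of_hasCompactSupport
      (hsd i j).mul_left
  have hint2 : ∀ i j, Integrable (fun x => d2 (fun y => a (y, t) i j) x j i *
      (max (U (x, t) - w (x, t)) 0) ^ 3) := fun i j =>
    ((continuous_d2 (H.ha2 t ht0 i j) j i).mul hG.continuous).integrable_of_hasCompactSupport
      hsG.mul_left
  calc ∫ x : E n, 3 * (max (U (x, t) - w (x, t)) 0) ^ 2 * (Dt U (x, t) - Dt w (x, t))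
      ≤ ∫ x, ∑ i, ∑ j, a (x, t) i j *
          d2 (fun y => (max (U (y, t) - w (y, t)) 0) ^ 3) x i j := by
        refine integral_mono ?_ ?_ fun x => ?_
        · refine Continuous.integrable_of_hasCompactSupport ?_ hs2.mul_right
          refine Continuous.mul ?_ ((H.DtU_cont ht0).sub
            ((Dtw_cont hw.1).comp (by fun_prop : Continuous fun x : E n => (x, t))))
          exact continuous_const.mul ((hq.continuous.max continuous_const).pow 2)
        · exact integrable_finsetSum _ fun i _ => integrable_finsetSum _ fun j _ => hint i j
        · simp only [d2_G hq, d2_sub (H.hx t ht0) hwt]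
          have e : ∑ i, ∑ j, a (x, t) i j * (3 * (max (U (x, t) - w (x, t)) 0) ^ 2 *
                (d2 (fun x => U (x, t)) x i j - d2 (fun x => w (x, t)) x i j) +
              6 * max (U (x, t) - w (x, t)) 0 *
                (fderiv ℝ (fun x => U (x, t) - w (x, t)) x (EuclideanSpace.single i 1) *
                fderiv ℝ (fun x => U (x, t) - w (x, t)) x (EuclideanSpace.single j 1))) =
              3 * (max (U (x, t) - w (x, t)) 0) ^ 2 *
                (∑ i, ∑ j, a (x, t) i j * d2 (fun x => U (x, t)) x i j -
                  ∑ i, ∑ j, a (x, t) i j * d2 (fun x => w (x, t)) x i j) +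
              6 * max (U (x, t) - w (x, t)) 0 * ∑ i, ∑ j, a (x, t) i j *
                fderiv ℝ (fun x => U (x, t) - w (x, t)) x (EuclideanSpace.single i 1) *
                fderiv ℝ (fun x => U (x, t) - w (x, t)) x (EuclideanSpace.single j 1) := by
            simp only [Finset.mul_sum, ← Finset.sum_sub_distrib, ← Finset.sum_add_distrib]
            exact Finset.sum_congr rfl fun i _ => Finset.sum_congr rfl fun j _ => by ring
          rw [e, ← H.DtU x ht0]
          have h0 : 0 ≤ max (U (x, t) - w (x, t)) 0 := le_max_right _ _
          have h1 := H.hpsd x t ht0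
            (fun i => fderiv ℝ (fun x => U (x, t) - w (x, t)) x (EuclideanSpace.single i 1))
          have h2 := mul_nonneg (mul_nonneg (by norm_num : (0 : ℝ) ≤ 6) h0) h1
          rcases h0.eq_or_lt with h | h
          · rw [← h]; simp
          · obtain ⟨_, R', hR', h3⟩ := hw
            have h4 := (h3 t ht x (H.w_lt hα ht.1 h)).2
            unfold LVal at h4
            simp only [D2_eq_d2] at h4
            have h5 : 0 ≤ 3 * (max (U (x, t) - w (x, t)) 0) ^ 2 := by positivity
            have := mul_le_mul_of_nonneg_left h4 h5
            nlinarith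
    _ = ∑ i, ∑ j, ∫ x, a (x, t) i j *
          d2 (fun y => (max (U (y, t) - w (y, t)) 0) ^ 3) x i j := by
        rw [integral_finsetSum _ fun i _ => integrable_finsetSum _ fun j _ => hint i j]
        exact Finset.sum_congr rfl fun i _ => integral_finsetSum _ fun j _ => hint i j
    _ = ∑ i, ∑ j, ∫ x, d2 (fun y => a (y, t) i j) x j i *
          (max (U (x, t) - w (x, t)) 0) ^ 3 :=
        Finset.sum_congr rfl fun i _ => Finset.sum_congr rfl fun j _ =>
          ibp2 (H.ha2 t ht0 i j) hG hsG i j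
    _ = ∫ x, ∑ i, ∑ j, d2 (fun y => a (y, t) i j) x j i *
          (max (U (x, t) - w (x, t)) 0) ^ 3 := by
        rw [integral_finsetSum _ fun i _ => integrable_finsetSum _ fun j _ => hint2 i j]
        exact Finset.sum_congr rfl fun i _ => (integral_finsetSum _ fun j _ => hint2 i j).symm
    _ ≤ ∫ x, Ca * (max (U (x, t) - w (x, t)) 0) ^ 3 := by
        refine integral_mono
          (integrable_finsetSum _ fun i _ => integrable_finsetSum _ fun j _ => hint2 i j)
          ((hG.continuous.integrable_of_hasCompactSupport hsG).const_mul _) fun x => ?_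
        simp only [← Finset.sum_mul]
        rcases le_total R ‖x‖ with hx | hx
        · rw [H.q_zero hα hw ht hx]; simp
        · exact mul_le_mul_of_nonneg_right (H.hCa t ⟨hα.trans ht.1, ht.2⟩ x hx)
            (pow_nonneg (le_max_right _ _) 3)
    _ = Ca * JJ U w t := integral_const_mul _ _

end

section
variable {n : ℕ}

lemma d2_eq_B {f : E n → ℝ} (hf : ContDiff ℝ 2 f) (x : E n) (i j : Fin n) :
    d2 f x i j = fderiv ℝ (fderiv ℝ f) x (EuclideanSpace.single i 1)
      (EuclideanSpace.single j 1) := by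
  unfold d2
  have h : DifferentiableAt ℝ (fderiv ℝ f) x :=
    (hf.fderiv_right (m := 1) (by norm_num)).differentiable (by norm_num) x
  rw [fderiv_clm_apply h (differentiableAt_const _)]
  simp

lemma d2_symm {f : E n → ℝ} (hf : ContDiff ℝ 2 f) (x : E n) (i j : Fin n) :
    d2 f x i j = d2 f x j i := by
  rw [d2_eq_B hf, d2_eq_B hf]
  have := (hf.contDiffAt (x := x)).isSymmSndFDerivAt (by simp)
  exact this _ _

lemma second_deriv_nonpos {g : ℝ → ℝ} (hg : IsLocalMax g 0) (hc : ContinuousAt g 0) :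
    deriv (deriv g) 0 ≤ 0 := by
  by_contra h
  push Not at h
  have h1 := isLocalMin_of_deriv_deriv_pos h hg.deriv_eq_zero hc
  have h2 : g =ᶠ[nhds 0] fun _ => g 0 := by
    filter_upwards [hg, h1] with s hs1 hs2
    exact le_antisymm hs1 hs2
  have h3 : deriv g =ᶠ[nhds 0] deriv (fun _ => g 0) := h2.deriv
  have h4 := h3.deriv_eq
  simp at h4
  linarith

lemma vec_eq_sum (ξ : Fin n → ℝ) :
    (WithLp.toLp 2 ξ : E n) = ∑ i, ξ i • (EuclideanSpace.single i 1 : E n) := by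
  ext k
  simp [Pi.single_apply]

lemma touch {f : E n → ℝ} (hf : ContDiff ℝ 2 f) {x : E n} {R k : ℝ} (hx : ‖x‖ < R)
    {p : E n →L[ℝ] ℝ}
    (h : ∀ z, ‖z‖ ≤ R → f z ≤ f x + p (z - x) + k * ‖z - x‖ ^ 2) (ξ : Fin n → ℝ) :
    0 ≤ ∑ i, ∑ j, ((if i = j then 2 * k else 0) - d2 f x i j) * ξ i * ξ j := by
  set v : E n := WithLp.toLp 2 ξ with hv
  set g : ℝ → ℝ := fun s => f (x + s • v) - s * p v - k * s ^ 2 * ‖v‖ ^ 2 with hg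
  have hline : ∀ s : ℝ, HasDerivAt (fun s : ℝ => x + s • v) v s := fun s => by
    simpa using ((hasDerivAt_id s).smul_const v).const_add x
  have hD : Differentiable ℝ f := hf.differentiable (by norm_num)
  have hD2 : Differentiable ℝ (fderiv ℝ f) :=
    (hf.fderiv_right (m := 1) (by norm_num)).differentiable (by norm_num)
  have hd : ∀ s, HasDerivAt g (fderiv ℝ f (x + s • v) v - p v - k * (2 * s) * ‖v‖ ^ 2) s := by
    intro s
    have h1 := (hD (x + s • v)).hasFDerivAt.comp_hasDerivAt s (hline s)
    have h2 := ((h1.sub ((hasDerivAt_id s).mul_const (p v))).sub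
      ((((hasDerivAt_id s).pow 2).const_mul k).mul_const (‖v‖ ^ 2)))
    simp only [one_mul] at h2
    exact (show HasDerivAt g _ s from h2).congr_deriv (by simp)
  have hdd : HasDerivAt (deriv g) (fderiv ℝ (fderiv ℝ f) x v v - k * 2 * ‖v‖ ^ 2) 0 := by
    have e : deriv g = fun s => fderiv ℝ f (x + s • v) v - p v - k * (2 * s) * ‖v‖ ^ 2 :=
      funext fun s => (hd s).deriv
    rw [e]
    have h0 : HasFDerivAt (fderiv ℝ f) (fderiv ℝ (fderiv ℝ f) x) (x + (0 : ℝ) • v) := by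
      simpa using (hD2 x).hasFDerivAt
    have h1 := h0.comp_hasDerivAt (0 : ℝ) (hline 0)
    have h2 := h1.clm_apply (hasDerivAt_const (0 : ℝ) v)
    have h3 := ((h2.sub_const (p v)).sub
      ((((hasDerivAt_id (0 : ℝ)).const_mul 2).const_mul k).mul_const (‖v‖ ^ 2)))
    exact (show HasDerivAt (fun s : ℝ =>
      fderiv ℝ f (x + s • v) v - p v - k * (2 * s) * ‖v‖ ^ 2) _ 0 from h3).congr_deriv (by simp)
  have hmax : IsLocalMax g 0 := by
    have hcont : ContinuousAt (fun s : ℝ => ‖x + s • v‖) 0 := by fun_prop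
    have : ∀ᶠ s : ℝ in nhds 0, ‖x + s • v‖ < R :=
      hcont.eventually_lt continuousAt_const (by simpa using hx)
    filter_upwards [this] with s hs
    have := h _ hs.le
    simp only [add_sub_cancel_left, map_smul, smul_eq_mul, norm_smul, mul_pow,
      Real.norm_eq_abs, sq_abs] at this
    simp only [hg, zero_smul, add_zero]
    nlinarith
  have hres := second_deriv_nonpos hmax (hd 0).continuousAt
  rw [hdd.deriv] at hres
  have e1 : fderiv ℝ (fderiv ℝ f) x v v = ∑ i, ∑ j, d2 f x i j * ξ i * ξ j := by
    simp only [d2_eq_B hf]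
    rw [hv, vec_eq_sum]
    simp only [map_sum, map_smul, sum_apply, smul_apply,
      smul_eq_mul, Finset.mul_sum]
    rw [Finset.sum_comm]
    exact Finset.sum_congr rfl fun i _ => Finset.sum_congr rfl fun j _ => by ring
  have e2 : ‖v‖ ^ 2 = ∑ i, ξ i ^ 2 := by
    rw [EuclideanSpace.norm_sq_eq]; simp [hv]
  have e3 : ∑ i, ∑ j, ((if i = j then 2 * k else 0) - d2 f x i j) * ξ i * ξ j =
      2 * k * ‖v‖ ^ 2 - ∑ i, ∑ j, d2 f x i j * ξ i * ξ j := by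
    rw [e2, Finset.mul_sum, ← Finset.sum_sub_distrib]
    refine Finset.sum_congr rfl fun i _ => ?_
    have : 2 * k * ξ i ^ 2 = ∑ j, (if i = j then 2 * k else 0) * ξ i * ξ j := by
      simp [Finset.sum_ite_eq, ite_mul]; ring
    rw [this, ← Finset.sum_sub_distrib]
    exact Finset.sum_congr rfl fun j _ => by ring
  rw [e3, ← e1]
  linarith

lemma taylor {f : E n → ℝ} (hf : ContDiff ℝ 2 f) (R : ℝ) :
    ∃ C : ℝ, 0 ≤ C ∧ ∀ x, ‖x‖ ≤ R → ‖fderiv ℝ f x‖ ≤ C ∧ ∀ z, ‖z‖ ≤ R →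
      f z ≤ f x + fderiv ℝ f x (z - x) + C * ‖z - x‖ ^ 2 := by
  have hD : Differentiable ℝ f := hf.differentiable (by norm_num)
  have hf1 : ContDiff ℝ 1 (fderiv ℝ f) := hf.fderiv_right (m := 1) (by norm_num)
  have hD2 : Differentiable ℝ (fderiv ℝ f) := hf1.differentiable (by norm_num)
  obtain ⟨C1, hC1⟩ := (isCompact_closedBall (0 : E n) R).exists_bound_of_continuousOn
    hf1.continuous.continuousOn
  obtain ⟨C2, hC2⟩ := (isCompact_closedBall (0 : E n) R).exists_bound_of_continuousOn
    (hf1.continuous_fderiv (by norm_num)).continuousOn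
  refine ⟨max (max C1 C2) 0, le_max_right _ _, fun x hx => ?_⟩
  have hx' : x ∈ closedBall (0 : E n) R := by simpa using hx
  refine ⟨(hC1 x hx').trans ((le_max_left _ _).trans (le_max_left _ _)), fun z hz => ?_⟩
  have hz' : z ∈ closedBall (0 : E n) R := by simpa using hz
  set C := max (max C1 C2) 0
  have hC0 : 0 ≤ C := le_max_right _ _
  have hseg : segment ℝ x z ⊆ closedBall (0 : E n) R :=
    (convex_closedBall (0 : E n) R).segment_subset hx' hz'
  have h1 : ∀ y ∈ segment ℝ x z, ‖fderiv ℝ f y - fderiv ℝ f x‖ ≤ C * ‖z - x‖ := by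
    intro y hy
    have := (convex_closedBall (0 : E n) R).norm_image_sub_le_of_norm_fderiv_le (𝕜 := ℝ)
      (f := fderiv ℝ f) (C := C)
      (fun u _ => hD2 u)
      (fun u hu => (hC2 u hu).trans ((le_max_right _ _).trans (le_max_left _ _))) hx' (hseg hy)
    refine this.trans (mul_le_mul_of_nonneg_left ?_ hC0)
    obtain ⟨s, hs, rfl⟩ := (segment_eq_image' ℝ x z) ▸ hy
    simp only [add_sub_cancel_left, norm_smul, Real.norm_eq_abs]
    rw [abs_of_nonneg hs.1]
    exact mul_le_of_le_one_left (norm_nonneg _) hs.2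
  have h2 := (convex_segment x z).norm_image_sub_le_of_norm_fderiv_le' (𝕜 := ℝ) (f := f)
    (fun u _ => hD u) h1 (left_mem_segment ℝ x z) (right_mem_segment ℝ x z)
  have h3 := (abs_le.mp (Real.norm_eq_abs _ ▸ h2)).2
  nlinarith

/-- Times at which `U` is uniformly touched from above by paraboloids of opening `k`. -/
def TK (U : E n × ℝ → ℝ) (R : ℝ) (k : ℝ) : Set ℝ :=
  {t | ∀ x : E n, ‖x‖ ≤ R → ∃ p : E n →L[ℝ] ℝ, ‖p‖ ≤ k ∧ ∀ z, ‖z‖ ≤ R →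
    U (z, t) ≤ U (x, t) + p (z - x) + k * ‖z - x‖ ^ 2}

variable {a : E n × ℝ → Fin n → Fin n → ℝ} {U w : E n × ℝ → ℝ} {Λ M τ T R Ca α : ℝ}

lemma Ctx.TK_cover (H : Ctx a U Λ M τ T R Ca) {t : ℝ} (ht : 0 < t) :
    ∃ k : ℕ, t ∈ TK U R k := by
  obtain ⟨C, hC0, hC⟩ := taylor (H.hx t ht) R
  obtain ⟨k, hk⟩ := exists_nat_ge C
  refine ⟨k, fun x hx => ⟨_, (hC x hx).1.trans hk, fun z hz => ((hC x hx).2 z hz).trans ?_⟩⟩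
  gcongr

lemma Ctx.TK_closed (H : Ctx a U Λ M τ T R Ca) {P : Set ℝ} (hP : P ⊆ Icc τ T) (k : ℝ) :
    IsClosed {s : P | (s : ℝ) ∈ TK U R k} := by
  rw [← isSeqClosed_iff_isClosed]
  intro s t hs hst
  have hst' : Tendsto (fun m => (s m : ℝ)) atTop (nhds (t : ℝ)) :=
    (continuous_subtype_val.tendsto t).comp hst
  have ht0 : 0 < (t : ℝ) := H.hτ.trans_le (hP t.2).1
  have hU : ∀ z, Tendsto (fun m => U (z, (s m : ℝ))) atTop (nhds (U (z, (t : ℝ)))) := fun z =>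
    ((H.ht z t ht0).continuousAt.tendsto).comp hst'
  intro x hx
  choose p hp1 hp2 using fun m => hs m x hx
  obtain ⟨p0, hp0, φ, hφ, hlim⟩ := (isCompact_closedBall (0 : E n →L[ℝ] ℝ) k).tendsto_subseq
    (x := p) (fun m => by simpa using hp1 m)
  refine ⟨p0, by simpa using hp0, fun z hz => ?_⟩
  refine le_of_tendsto_of_tendsto ((hU z).comp hφ.tendsto_atTop)
    ((((hU x).comp hφ.tendsto_atTop).add
      (((ContinuousLinearMap.apply ℝ ℝ (z - x)).continuous.tendsto p0).comp hlim)).add_const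
      (k * ‖z - x‖ ^ 2)) (Eventually.of_forall fun m => ?_)
  exact hp2 (φ m) z hz

lemma Ctx.trace_le (H : Ctx a U Λ M τ T R Ca) {k t : ℝ} (hk : 0 ≤ k) (ht : 0 < t) (x : E n) :
    ∑ i, ∑ j, a (x, t) i j * (if i = j then 2 * k else 0) ≤ 2 * k * n * Λ := by
  have : ∀ i, ∑ j, a (x, t) i j * (if i = j then 2 * k else 0) ≤ 2 * k * Λ := by
    intro i
    simp only [mul_ite, mul_zero, Finset.sum_ite_eq, Finset.mem_univ, if_true]
    nlinarith [(abs_le.mp (H.hΛ x t ht i i)).2]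
  refine (Finset.sum_le_sum fun i _ => this i).trans_eq ?_
  simp; ring

lemma Ctx.DtU_le (H : Ctx a U Λ M τ T R Ca) {k t : ℝ} (hk : 0 ≤ k) (ht : 0 < t)
    (hT : t ∈ TK U R k) {x : E n} (hx : ‖x‖ < R) : Dt U (x, t) ≤ 2 * k * n * Λ := by
  obtain ⟨p, -, hp⟩ := hT x hx.le
  have h1 := trace_nonneg (H.hpsd x t ht) (fun i j => by
    rw [d2_symm (H.hx t ht) x i j, ite_cond_congr (eq_iff_iff.mpr eq_comm)])
    (touch (H.hx t ht) hx hp)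
  have h2 := H.trace_le hk ht x
  rw [H.DtU x ht]
  simp only [mul_sub, Finset.sum_sub_distrib] at h1
  linarith

end

lemma antitone_of_slope {f : ℝ → ℝ} {s t : ℝ} (hf : ContinuousOn f (Icc s t))
    (h : ∀ x ∈ Ioo s t, ∀ r, 0 < r → ∃ᶠ z in nhdsWithin x (Ioi x), slope f x z < r) :
    AntitoneOn f (Icc s t) := by
  have key : ∀ x y, s < x → x ≤ y → y ≤ t → f y ≤ f x := by
    intro x y hsx hxy hyt
    have := image_le_of_liminf_slope_right_le_deriv_boundary (f := f) (a := x) (b := y)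
      (B := fun _ => f x) (B' := fun _ => 0)
      (hf.mono (Icc_subset_Icc hsx.le hyt)) le_rfl continuousOn_const
      (fun z _ => hasDerivWithinAt_const _ _ _)
      (fun z hz r hr => h z ⟨hsx.trans_le hz.1, hz.2.trans_le hyt⟩ r hr)
    exact this (right_mem_Icc.mpr hxy)
  intro x hx y hy hxy
  rcases hx.1.eq_or_lt with h1 | h1
  · rcases hxy.eq_or_lt with h2 | h2
    · rw [h2]
    · have hc : Tendsto f (nhdsWithin x (Ioo x y)) (nhds (f x)) :=
        (hf x hx).mono_left (nhdsWithin_mono _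
          (fun z hz => ⟨hx.1.trans hz.1.le, hz.2.le.trans hy.2⟩))
      have : (nhdsWithin x (Ioo x y)).NeBot := left_nhdsWithin_Ioo_neBot h2
      refine ge_of_tendsto hc ?_
      filter_upwards [self_mem_nhdsWithin] with z hz
      exact key z y (h1 ▸ hz.1) hz.2.le hy.2
  · exact key x y h1 hxy hy.2

section
variable {n : ℕ}

/-- Times near which all the functionals are antitone. -/
def OO (a : E n × ℝ → Fin n → Fin n → ℝ) (U : E n × ℝ → ℝ) (τ T R Ca : ℝ) : Set ℝ :=
  {t | ∃ δ > 0, ∀ α ∈ Icc τ T, ∀ w, Adm a T R α w →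
    AntitoneOn (Ph Ca U w) (Ioo (t - δ) (t + δ) ∩ Icc α T)}

variable {a : E n × ℝ → Fin n → Fin n → ℝ} {U w : E n × ℝ → ℝ} {Λ M τ T R Ca α : ℝ}

lemma isOpen_OO : IsOpen (OO a U τ T R Ca) := by
  rw [Metric.isOpen_iff]
  rintro t ⟨δ, hδ, h⟩
  refine ⟨δ / 2, half_pos hδ, fun s hs => ⟨δ / 2, half_pos hδ, fun α hα w hw => ?_⟩⟩
  refine (h α hα w hw).mono (inter_subset_inter_left _ ?_)
  rw [Metric.mem_ball, Real.dist_eq, abs_lt] at hs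
  exact Ioo_subset_Ioo (by linarith) (by linarith)

lemma slope_nonpos_of_antitone {f : ℝ → ℝ} {x b r : ℝ} (hxb : x < b)
    (h : AntitoneOn f (Icc x b)) (hr : 0 < r) :
    ∃ᶠ z in nhdsWithin x (Ioi x), slope f x z < r := by
  refine Eventually.frequently ?_
  filter_upwards [Ioo_mem_nhdsGT hxb] with z hz
  refine lt_of_le_of_lt ?_ hr
  rw [slope_def_field]
  refine div_nonpos_of_nonpos_of_nonneg ?_ (by linarith [hz.1])
  linarith [h (left_mem_Icc.mpr hxb.le) ⟨hz.1.le, hz.2.le⟩ hz.1.le]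

lemma slope_of_mem_OO {x b r : ℝ} (hx : x ∈ OO a U τ T R Ca) (hα : α ∈ Icc τ T)
    (hw : Adm a T R α w) (hxα : α ≤ x) (hxb : x < b) (hbT : b ≤ T) (hr : 0 < r) :
    ∃ᶠ z in nhdsWithin x (Ioi x), slope (Ph Ca U w) x z < r := by
  obtain ⟨δ, hδ, h⟩ := hx
  refine slope_nonpos_of_antitone (b := min b (x + δ / 2)) (lt_min hxb (by linarith)) ?_ hr
  refine (h α hα w hw).mono fun z hz => ?_
  have := hz.2.trans (min_le_right _ _)
  have := hz.2.trans (min_le_left _ _)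
  exact ⟨⟨by linarith [hz.1], by linarith⟩, by linarith [hz.1], by linarith⟩

lemma Ctx.gap (H : Ctx a U Λ M τ T R Ca) (hα : α ∈ Icc τ T) (hw : Adm a T R α w) {s t : ℝ}
    (hs : α ≤ s) (ht : t ≤ T) (hO : Ioo s t ⊆ OO a U τ T R Ca) :
    AntitoneOn (Ph Ca U w) (Icc s t) := by
  refine antitone_of_slope ((H.Ph_cont hα.1 hw).mono (Icc_subset_Icc hs ht)) fun x hx r hr => ?_
  exact slope_of_mem_OO (hO hx) hα hw (hs.trans hx.1.le) hx.2 ht hr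

lemma Ctx.le_of_antitone (H : Ctx a U Λ M τ T R Ca) (hα : α ∈ Icc τ T) (hw : Adm a T R α w)
    {s t : ℝ} (hs : α ≤ s) (ht : t ≤ T) (hst : s ≤ t)
    (hanti : AntitoneOn (Ph Ca U w) (Icc s t))
    (h0 : ∀ x, U (x, s) ≤ w (x, s)) (x : E n) : U (x, t) ≤ w (x, t) := by
  refine H.J_zero hα.1 hw ⟨hs.trans hst, ht⟩ ?_ x
  have h1 : Ph Ca U w t ≤ Ph Ca U w s :=
    hanti (left_mem_Icc.mpr hst) (right_mem_Icc.mpr hst) hst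
  have h2 : Ph Ca U w s = 0 := by unfold Ph; rw [JJ_of_le h0, mul_zero]
  have h3 : Ph Ca U w t = 0 := le_antisymm (h2 ▸ h1) (Ph_nonneg t)
  unfold Ph at h3
  exact (mul_eq_zero.mp h3).resolve_left (Real.exp_pos _).ne'

/-- The quadratic barrier. -/
def qb (x0 : E n) (p : E n →L[ℝ] ℝ) (c A B s0 : ℝ) (X : E n × ℝ) : ℝ :=
  c + p (X.1 - x0) + A * ‖X.1 - x0‖ ^ 2 + B * (X.2 - s0)

lemma qb_contDiff (x0 : E n) (p : E n →L[ℝ] ℝ) (c A B s0 : ℝ) :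
    ContDiff ℝ 2 (qb x0 p c A B s0) := by
  unfold qb
  have h1 : ContDiff ℝ 2 (fun X : E n × ℝ => ‖X.1 - x0‖ ^ 2) :=
    (contDiff_fst.sub contDiff_const).norm_sq ℝ
  have h2 : ContDiff ℝ 2 (fun X : E n × ℝ => p (X.1 - x0)) :=
    p.contDiff.comp (contDiff_fst.sub contDiff_const)
  exact ((contDiff_const.add h2).add (contDiff_const.mul h1)).add
    (contDiff_const.mul (contDiff_snd.sub contDiff_const))

lemma hasFDerivAt_nsq (x0 y : E n) :
    HasFDerivAt (fun z : E n => ‖z - x0‖ ^ 2) (2 • (innerSL ℝ (y - x0))) y := by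
  have := ((hasFDerivAt_id (𝕜 := ℝ) y).sub_const x0).norm_sq
  simpa using this

lemma hasFDerivAt_coord (x0 y : E n) (j : Fin n) :
    HasFDerivAt (fun z : E n => (z - x0) j) (EuclideanSpace.proj (𝕜 := ℝ) j) y := by
  have := (EuclideanSpace.proj (𝕜 := ℝ) j : E n →L[ℝ] ℝ).hasFDerivAt.comp y
    ((hasFDerivAt_id (𝕜 := ℝ) y).sub_const x0)
  exact this

lemma qb_d2 (x0 : E n) (p : E n →L[ℝ] ℝ) (c A B s0 : ℝ) (X : E n × ℝ) (i j : Fin n) :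
    D2 (qb x0 p c A B s0) X i j = if i = j then 2 * A else 0 := by
  unfold D2
  have h1 : (fun x => fderiv ℝ (fun x' => qb x0 p c A B s0 (x', X.2)) x
      (EuclideanSpace.single j 1)) = fun x => p (EuclideanSpace.single j 1) +
        2 * A * (x - x0) j := by
    funext x
    have h2 : HasFDerivAt (fun z : E n => p (z - x0)) p x := by
      have := p.hasFDerivAt.comp x ((hasFDerivAt_id (𝕜 := ℝ) x).sub_const x0)
      exact this
    have h3 := (((h2.const_add c).add ((hasFDerivAt_nsq x0 x).const_mul A)).add_const
      (B * (X.2 - s0)))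
    have h4 : HasFDerivAt (fun x' => qb x0 p c A B s0 (x', X.2)) _ x := h3
    rw [h4.fderiv]
    simp [EuclideanSpace.inner_single_right]
    ring
  rw [h1]
  have h5 := (((hasFDerivAt_coord x0 X.1 j).const_mul (2 * A)).const_add
    (p (EuclideanSpace.single j 1)))
  rw [h5.fderiv]
  simp [eq_comm]

lemma qb_dt (x0 : E n) (p : E n →L[ℝ] ℝ) (c A B s0 : ℝ) (X : E n × ℝ) :
    Dt (qb x0 p c A B s0) X = B := by
  unfold Dt qb
  have := (((hasDerivAt_id X.2).sub_const s0).const_mul B).const_add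
    (c + p (X.1 - x0) + A * ‖X.1 - x0‖ ^ 2)
  exact this.deriv.trans (mul_one B)

lemma Ctx.barrier (H : Ctx a U Λ M τ T R Ca) (hM : 0 ≤ M) (hΛ : 0 ≤ Λ) {k R' : ℝ} (hk : 0 ≤ k)
    (hR : R' < R) :
    ∃ B : ℝ, 0 ≤ B ∧ 2 * k * n * Λ ≤ B ∧ ∀ α ∈ Icc τ T, α ∈ TK U R k → ∀ β ≤ T,
      Ioo α β ⊆ OO a U τ T R Ca → ∀ x0 : E n, ‖x0‖ ≤ R' → ∀ s ∈ Icc α β,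
      U (x0, s) ≤ U (x0, α) + B * (s - α) := by
  set ρ := (R - R') / 2 with hρ
  have hρ0 : 0 < ρ := by rw [hρ]; linarith
  set A := (M + k * ρ) / ρ ^ 2 + k + 1 with hA
  have hA1 : 0 ≤ (M + k * ρ) / ρ ^ 2 := by positivity
  have hA0 : 0 ≤ A := by rw [hA]; linarith
  refine ⟨2 * A * n * Λ, by positivity, ?_, ?_⟩
  · have : k ≤ A := by rw [hA]; linarith
    gcongr
  intro α hα hTK β hβ hO x0 hx0 s hs
  obtain ⟨p, hp1, hp2⟩ := hTK x0 (hx0.trans hR.le)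
  set w := qb x0 p (U (x0, α)) A (2 * A * n * Λ) α with hw
  have hα0 : 0 < α := H.hτ.trans_le hα.1
  have hpos : ∀ t, α ≤ t → ∀ x, ρ < ‖x - x0‖ → 0 < w (x, t) := by
    intro t ht x hx
    have h1 : -(k * ‖x - x0‖) ≤ p (x - x0) := by
      have h := (p.le_opNorm (x - x0)).trans (mul_le_mul_of_nonneg_right hp1 (norm_nonneg _))
      rw [Real.norm_eq_abs] at h
      exact (abs_le.mp h).1
    have h2 := H.hM x0 α hα0
    have h3 : 0 ≤ 2 * A * n * Λ * (t - α) := mul_nonneg (by positivity) (by linarith)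
    have h4 : M + k * ‖x - x0‖ ≤ (M + k * ρ) / ρ ^ 2 * ‖x - x0‖ ^ 2 := by
      rw [div_mul_eq_mul_div, le_div_iff₀ (by positivity)]
      set d := ‖x - x0‖
      have e1 : ρ ^ 2 ≤ d ^ 2 := by gcongr
      have e2 : ρ * d ≤ d * d := by gcongr
      nlinarith [mul_le_mul_of_nonneg_left e1 hM, mul_le_mul_of_nonneg_left e2
        (mul_nonneg hk hρ0.le)]
    have h5 : 0 < ‖x - x0‖ ^ 2 := by have := hρ0.trans hx; positivity
    have h6 : 0 ≤ k * ‖x - x0‖ ^ 2 := by positivity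
    have h7 : w (x, t) = U (x0, α) + p (x - x0) + A * ‖x - x0‖ ^ 2 +
      2 * A * n * Λ * (t - α) := rfl
    have h8 : A * ‖x - x0‖ ^ 2 = (M + k * ρ) / ρ ^ 2 * ‖x - x0‖ ^ 2 + k * ‖x - x0‖ ^ 2 +
      ‖x - x0‖ ^ 2 := by rw [hA]; ring
    rw [h7, h8]
    linarith
  have hadm : Adm a T R α w := by
    refine ⟨qb_contDiff _ _ _ _ _ _, R' + ρ, by rw [hρ]; linarith, fun t ht x hx => ⟨?_, ?_⟩⟩
    · have : ‖x - x0‖ ≤ ρ := by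
        by_contra hc
        exact absurd (hpos t ht.1 x (not_le.mp hc)) (not_lt.mpr hx)
      calc ‖x‖ = ‖x0 + (x - x0)‖ := by congr 1; abel
        _ ≤ ‖x0‖ + ‖x - x0‖ := norm_add_le _ _
        _ ≤ R' + ρ := by linarith
    · unfold LVal
      rw [hw, qb_dt]
      simp only [qb_d2]
      linarith [H.trace_le hA0 (hα0.trans_le ht.1) x]
  have hfin := H.le_of_antitone hα hadm le_rfl (hs.2.trans hβ) hs.1
    (H.gap hα hadm le_rfl (hs.2.trans hβ) ((Ioo_subset_Ioo_right hs.2).trans hO)) ?_ x0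
  · have : w (x0, s) = U (x0, α) + 2 * A * n * Λ * (s - α) := by
      simp [hw, qb]
    linarith
  · intro x
    rcases le_or_gt ‖x‖ R with hx | hx
    · have h1 := hp2 x hx
      have h7 : w (x, α) = U (x0, α) + p (x - x0) + A * ‖x - x0‖ ^ 2 := by simp [hw, qb]
      have : k * ‖x - x0‖ ^ 2 ≤ A * ‖x - x0‖ ^ 2 := by
        gcongr; rw [hA]; linarith
      linarith
    · have h1 : ρ < ‖x - x0‖ := by
        have : ‖x‖ ≤ ‖x0‖ + ‖x - x0‖ := by
          calc ‖x‖ = ‖x0 + (x - x0)‖ := by congr 1; abel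
            _ ≤ _ := norm_add_le _ _
        rw [hρ]; linarith
      linarith [hpos α le_rfl x h1, H.hU0 x α hα0]

lemma exists_next {P : Set ℝ} (hP : IsClosed P) {s e z : ℝ} (hz : z ∈ P) (hsz : s < z)
    (hse : s < e) (he : ∀ y ∈ Ioo s e, y ∉ P) :
    ∃ β ∈ P, s < β ∧ β ≤ z ∧ ∀ y ∈ Ioo s β, y ∉ P := by
  have hezs : e ≤ z := by
    by_contra hc
    exact he z ⟨hsz, not_le.mp hc⟩ hz
  have hc : IsCompact (P ∩ Icc e z) := isCompact_Icc.inter_left hP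
  obtain ⟨β, hβ, hl⟩ := hc.exists_isLeast ⟨z, hz, hezs, le_rfl⟩
  refine ⟨β, hβ.1, hse.trans_le hβ.2.1, hβ.2.2, fun y hy hyP => ?_⟩
  rcases lt_or_ge y e with h | h
  · exact he y ⟨hy.1, h⟩ hyP
  · exact absurd (hl ⟨hyP, h, hy.2.le.trans hβ.2.2⟩) (not_le.mpr hy.2)

lemma Ctx.lip (H : Ctx a U Λ M τ T R Ca) (hM : 0 ≤ M) (hΛ : 0 ≤ Λ) {k R' : ℝ} (hk : 0 ≤ k)
    (hR : R' < R) :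
    ∃ B : ℝ, 0 ≤ B ∧ ∀ t z : ℝ, t ≤ z → t ∈ Icc τ T \ OO a U τ T R Ca →
      z ∈ Icc τ T \ OO a U τ T R Ca →
      (Icc t z ∩ (Icc τ T \ OO a U τ T R Ca) ⊆ TK U R k) → ∀ x : E n, ‖x‖ ≤ R' →
      U (x, z) - U (x, t) ≤ B * (z - t) := by
  obtain ⟨B, hB0, hBk, hB⟩ := H.barrier hM hΛ hk hR
  refine ⟨B + 1, by linarith, fun t z htz ht hz hTK x hx => ?_⟩
  set P := Icc τ T \ OO a U τ T R Ca with hPdef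
  have hPc : IsClosed P := isClosed_Icc.sdiff isOpen_OO
  have hcontU : ∀ s ∈ Icc t z, ContinuousAt (fun r => U (x, r)) s := fun s hs =>
    (H.ht x s (H.hτ.trans_le (ht.1.1.trans hs.1))).continuousAt
  set S := (P ∩ Icc t z) ∩ {s | U (x, s) - (B + 1) * s ≤ U (x, t) - (B + 1) * t} with hS
  have hScl : IsClosed (Icc t z ∩ {s | U (x, s) - (B + 1) * s ≤ U (x, t) - (B + 1) * t}) := by
    have hco : ContinuousOn (fun s => U (x, s) - (B + 1) * s) (Icc t z) := fun s hs =>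
      ((hcontU s hs).sub (by fun_prop)).continuousWithinAt
    exact hco.preimage_isClosed_of_isClosed isClosed_Icc isClosed_Iic
  have hSc : IsCompact S := by
    rw [hS, inter_assoc]
    exact (isCompact_Icc.of_isClosed_subset hScl inter_subset_left).inter_left hPc
  obtain ⟨s, hs, hmax⟩ := hSc.exists_isGreatest ⟨t, ⟨ht, le_rfl, htz⟩, le_refl (U (x, t) - (B + 1) * t)⟩
  obtain ⟨⟨hsP, hsI⟩, hsle⟩ := hs
  simp only [mem_ofPred_eq] at hsle
  rcases hsI.2.eq_or_lt with h | h
  · rw [h] at hsle; linarith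
  exfalso
  have hs0 : 0 < s := H.hτ.trans_le hsP.1.1
  have hsTK : s ∈ TK U R k := hTK ⟨hsI, hsP⟩
  have hd : HasDerivAt (fun r => U (x, r)) (Dt U (x, s)) s := (H.ht x s hs0).hasDerivAt
  have hdle : Dt U (x, s) < B + 1 := by
    linarith [H.DtU_le hk hs0 hsTK (hx.trans_lt hR)]
  have hsl := (hasDerivAt_iff_tendsto_slope.mp hd).mono_left
    (nhdsWithin_mono s (fun y (hy : y ∈ Ioi s) => (ne_of_gt hy : y ≠ s)))
  have hev := hsl.eventually_lt_const hdle
  obtain ⟨e, he, hes⟩ := (mem_nhdsGT_iff_exists_Ioo_subset (a := s)).mp hev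
  have hno : ∀ y ∈ Ioo s (min e z), y ∉ P := by
    intro y hy hyP
    have h1 : slope (fun r => U (x, r)) s y < B + 1 := hes ⟨hy.1, hy.2.trans_le (min_le_left _ _)⟩
    rw [slope_def_field, div_lt_iff₀ (by linarith [hy.1])] at h1
    have := hmax ⟨⟨hyP, hsI.1.trans hy.1.le, (hy.2.trans_le (min_le_right _ _)).le⟩,
      by simp only [mem_ofPred_eq]; linarith⟩
    linarith [hy.1]
  obtain ⟨β, hβP, hsβ, hβz, hgap⟩ := exists_next hPc hz h (lt_min he h) hno
  have hO : Ioo s β ⊆ OO a U τ T R Ca := by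
    intro y hy
    by_contra hc
    exact hgap y hy ⟨⟨hsP.1.1.trans hy.1.le, hy.2.le.trans hβP.1.2⟩, hc⟩
  have h1 := hB s hsP.1 hsTK β hβP.1.2 hO x hx β ⟨hsβ.le, le_rfl⟩
  have := hmax ⟨⟨hβP, hsI.1.trans hsβ.le, hβz⟩, by simp only [mem_ofPred_eq]; nlinarith⟩
  linarith

end

lemma G_conv (b c : ℝ) :
    (max b 0) ^ 3 - (max c 0) ^ 3 ≤ 3 * (max b 0) ^ 2 * (b - c) := by
  have hb : 0 ≤ max b 0 := le_max_right _ _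
  have hc : 0 ≤ max c 0 := le_max_right _ _
  have hcc : c ≤ max c 0 := le_max_left _ _
  have h1 : (max b 0) ^ 2 * b = (max b 0) ^ 3 := by
    rcases le_total b 0 with h | h
    · rw [max_eq_right h]; norm_num
    · rw [max_eq_left h]; ring
  have h2 : (max b 0) ^ 2 * c ≤ (max b 0) ^ 2 * max c 0 := by gcongr
  generalize max b 0 = β at *
  generalize max c 0 = γ at *
  nlinarith [mul_nonneg (add_nonneg (mul_nonneg (by norm_num : (0 : ℝ) ≤ 2) hb) hc)
    (sq_nonneg (β - γ))]

section
variable {n : ℕ}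
variable {a : E n × ℝ → Fin n → Fin n → ℝ} {U w : E n × ℝ → ℝ} {Λ M τ T R Ca α : ℝ}

lemma Ctx.acc_slope (H : Ctx a U Λ M τ T R Ca) (hα : τ ≤ α) (hw : Adm a T R α w)
    {t : ℝ} (ht : t ∈ Icc α T) {Q : Set ℝ} (hQ : ∃ᶠ z in nhdsWithin t (Ioi t), z ∈ Q)
    (hQT : Q ⊆ Iic T)
    (hlip : ∀ R' < R, ∃ B : ℝ, 0 ≤ B ∧ ∀ z ∈ Q, t < z → ∀ x : E n, ‖x‖ ≤ R' →
      U (x, z) - U (x, t) ≤ B * (z - t)) {r : ℝ} (hr : 0 < r) :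
    ∃ᶠ z in nhdsWithin t (Ioi t), slope (Ph Ca U w) t z < r := by
  have ht0 : 0 < t := H.hτ.trans_le (hα.trans ht.1)
  set l := nhdsWithin t (Ioi t) ⊓ 𝓟 Q with hl
  have hne : l.NeBot := frequently_mem_iff_neBot.mp hQ
  suffices h : ∀ᶠ z in l, slope (Ph Ca U w) t z < r from
    h.frequently.filter_mono inf_le_left
  have hlgt : ∀ᶠ z in l, t < z ∧ z ∈ Q := by
    refine (Eventually.filter_mono inf_le_left self_mem_nhdsWithin).and ?_
    exact Eventually.filter_mono inf_le_right (mem_principal_self Q)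
  have hlne : l ≤ nhdsWithin t {t}ᶜ :=
    inf_le_left.trans (nhdsWithin_mono t (fun y (hy : y ∈ Ioi t) => (ne_of_gt hy : y ≠ t)))
  have hlnhds : l ≤ nhds t := inf_le_left.trans nhdsWithin_le_nhds
  have : l.IsCountablyGenerated := by rw [hl]; infer_instance
  obtain ⟨R', hR', hw2⟩ := hw.2
  obtain ⟨B, hB0, hB⟩ := hlip R' hR'
  obtain ⟨Cq, hCq0, hCq⟩ := H.q_bound hα hw
  obtain ⟨Lw, hLw0, hLw⟩ := exists_bound_w (w := fun X => Dt w X) (Dtw_cont hw.1) R α T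
  set F : ℝ → E n → ℝ := fun z x => ((max (U (x, z) - w (x, z)) 0) ^ 3 -
    (max (U (x, t) - w (x, t)) 0) ^ 3) / (z - t) with hF
  set L : E n → ℝ := fun x =>
    3 * (max (U (x, t) - w (x, t)) 0) ^ 2 * (Dt U (x, t) - Dt w (x, t)) with hLdef
  set C := 3 * Cq ^ 2 * (B + Lw) with hC
  have hC0 : 0 ≤ C := by positivity
  have hcontL : Continuous L := by
    refine Continuous.mul ?_ ((H.DtU_cont ht0).sub
      ((Dtw_cont hw.1).comp (by fun_prop : Continuous fun x : E n => (x, t))))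
    exact continuous_const.mul (((H.cdq hα hw ht.1).continuous.max continuous_const).pow 2)
  have hsL : HasCompactSupport L := by
    have hs2 : HasCompactSupport (fun x => 3 * (max (U (x, t) - w (x, t)) 0) ^ 2) :=
      (H.compact_supp hα hw ht).comp_left (g := fun r => 3 * r ^ 2) (by norm_num)
    exact hs2.mul_right
  have hintL : Integrable L := hcontL.integrable_of_hasCompactSupport hsL
  have hcG : ∀ z ∈ Icc α T, Continuous (fun x => (max (U (x, z) - w (x, z)) 0) ^ 3) :=
    fun z hz => ((H.cdq hα hw hz.1).continuous.max continuous_const).pow 3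
  have hiG : ∀ z ∈ Icc α T, Integrable (fun x => (max (U (x, z) - w (x, z)) 0) ^ 3) :=
    fun z hz => (hcG z hz).integrable_of_hasCompactSupport
      ((H.compact_supp hα hw hz).comp_left (g := fun r => r ^ 3) (by norm_num))
  have hzI : ∀ z, t < z → z ∈ Q → z ∈ Icc α T := fun z hz hzQ =>
    ⟨ht.1.trans hz.le, hQT hzQ⟩
  have hzero : ∀ z ∈ Icc α T, ∀ x, R' < ‖x‖ → max (U (x, z) - w (x, z)) 0 = 0 := by
    intro z hz x hx
    by_contra hc
    have h1 : 0 < max (U (x, z) - w (x, z)) 0 := lt_of_le_of_ne (le_max_right _ _) (Ne.symm hc)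
    have := (hw2 z hz x (H.w_lt hα hz.1 h1)).1
    linarith
  have hFC : ∀ z, t < z → z ∈ Q → ∀ x, F z x ≤ (closedBall (0 : E n) R').indicator (fun _ => C) x := by
    intro z hz hzQ x
    have hzI' := hzI z hz hzQ
    by_cases hx : x ∈ closedBall (0 : E n) R'
    · rw [indicator_of_mem hx]
      have hx' : ‖x‖ ≤ R' := by simpa using hx
      rw [hF]
      simp only
      rw [div_le_iff₀ (by linarith)]
      have h1 := hB z hzQ hz x hx'
      have h2 : ‖w (x, z) - w (x, t)‖ ≤ Lw * ‖z - t‖ := by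
        refine (convex_Icc α T).norm_image_sub_le_of_norm_hasDerivWithin_le
          (f := fun s => w (x, s)) (f' := fun s => Dt w (x, s)) (fun s hs => ?_)
          (fun s hs => hLw x (hx'.trans hR'.le) s hs) ht hzI'
        have := Dt_eq_fderiv hw.1 x s
        exact (this.differentiableAt.hasDerivAt).hasDerivWithinAt
      rw [Real.norm_eq_abs, Real.norm_eq_abs, abs_of_pos (by linarith : (0:ℝ) < z - t)] at h2
      have h3 := (abs_le.mp h2).1
      refine (G_conv _ _).trans ?_
      have h4 : (U (x, z) - w (x, z)) - (U (x, t) - w (x, t)) ≤ (B + Lw) * (z - t) := by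
        linarith
      have h5 : 0 ≤ (B + Lw) * (z - t) := mul_nonneg (by linarith) (by linarith)
      have h6 : (max (U (x, z) - w (x, z)) 0) ^ 2 ≤ Cq ^ 2 :=
        pow_le_pow_left₀ (le_max_right _ _) (hCq z hzI' x) 2
      calc 3 * (max (U (x, z) - w (x, z)) 0) ^ 2 * ((U (x, z) - w (x, z)) - (U (x, t) - w (x, t)))
          ≤ 3 * (max (U (x, z) - w (x, z)) 0) ^ 2 * ((B + Lw) * (z - t)) := by gcongr
        _ ≤ 3 * Cq ^ 2 * ((B + Lw) * (z - t)) := by gcongr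
        _ = C * (z - t) := by rw [hC]; ring
    · rw [indicator_of_notMem hx]
      have hx' : R' < ‖x‖ := by simpa using hx
      rw [hF]
      simp only
      rw [hzero z hzI' x hx', hzero t ht x hx']
      simp
  have hFlim : ∀ x, Tendsto (fun z => F z x) l (nhds (L x)) := by
    intro x
    have hd : HasDerivAt (fun s => U (x, s) - w (x, s)) (Dt U (x, t) - Dt w (x, t)) t :=
      (H.ht x t ht0).hasDerivAt.sub (Dt_eq_fderiv hw.1 x t).differentiableAt.hasDerivAt
    have h1 := (hasDerivAt_G (U (x, t) - w (x, t))).comp t hd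
    have h2 := (hasDerivAt_iff_tendsto_slope.mp h1).mono_left hlne
    refine h2.congr fun z => ?_
    rw [slope_def_field]; rfl
  have hlim : Tendsto (fun z => ∫ x, max (F z x) (L x)) l (nhds (∫ x, L x)) := by
    refine tendsto_integral_filter_of_dominated_convergence
      (fun x => ‖L x‖ + (closedBall (0 : E n) R').indicator (fun _ => C) x) ?_ ?_ ?_ ?_
    · filter_upwards [hlgt] with z hz
      have hzI' := hzI z hz.1 hz.2
      exact ((((hcG z hzI').sub (hcG t ht)).div_const _).max hcontL).aestronglyMeasurable
    · filter_upwards [hlgt] with z hz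
      refine Eventually.of_forall fun x => ?_
      have h1 := hFC z hz.1 hz.2 x
      have h2 : 0 ≤ (closedBall (0 : E n) R').indicator (fun _ => C) x :=
        indicator_nonneg (fun _ _ => hC0) x
      rw [Real.norm_eq_abs, Real.norm_eq_abs, abs_le]
      constructor
      · linarith [neg_abs_le (L x), le_max_right (F z x) (L x)]
      · exact max_le (by linarith [abs_nonneg (L x)]) (by linarith [le_abs_self (L x)])
    · refine hintL.norm.add ?_
      rw [integrable_indicator_iff isClosed_closedBall.measurableSet]
      exact integrableOn_const (isCompact_closedBall _ _).measure_lt_top.ne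
    · refine Eventually.of_forall fun x => ?_
      have := (hFlim x).max (tendsto_const_nhds (x := L x))
      simpa using this
  have hJ : ∀ z, t < z → z ∈ Q → slope (JJ U w) t z ≤ ∫ x, max (F z x) (L x) := by
    intro z hz hzQ
    have hzI' := hzI z hz hzQ
    have hiF : Integrable (F z) := ((hiG z hzI').sub (hiG t ht)).div_const _
    have : slope (JJ U w) t z = ∫ x, F z x := by
      rw [slope_def_field]
      simp only [hF, JJ]
      rw [integral_div, integral_sub (hiG z hzI') (hiG t ht)]
    rw [this]
    exact integral_mono hiF (hiF.sup hintL) fun x => le_max_left _ _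
  have hexp : HasDerivAt (fun s : ℝ => Real.exp (-(Ca * s))) (Real.exp (-(Ca * t)) * (-Ca)) t := by
    have := (((hasDerivAt_id t).const_mul Ca).neg).exp
    simpa using this
  have hup : Tendsto (fun z => Real.exp (-(Ca * z)) * (∫ x, max (F z x) (L x)) +
      JJ U w t * slope (fun s : ℝ => Real.exp (-(Ca * s))) t z) l
      (nhds (Real.exp (-(Ca * t)) * (∫ x, L x) +
        JJ U w t * (Real.exp (-(Ca * t)) * (-Ca)))) := by
    refine Tendsto.add (Tendsto.mul ?_ hlim) (Tendsto.const_mul _ ?_)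
    · exact hexp.continuousAt.tendsto.mono_left hlnhds
    · exact (hasDerivAt_iff_tendsto_slope.mp hexp).mono_left hlne
  have hle : Real.exp (-(Ca * t)) * (∫ x, L x) + JJ U w t * (Real.exp (-(Ca * t)) * (-Ca)) < r := by
    have h1 := mul_le_mul_of_nonneg_left (H.J_deriv hα hw ht) (Real.exp_pos (-(Ca * t))).le
    refine lt_of_le_of_lt ?_ hr
    linarith
  filter_upwards [hup.eventually_lt_const hle, hlgt] with z hz1 hz2
  refine lt_of_le_of_lt ?_ hz1
  have h1 := mul_le_mul_of_nonneg_left (hJ z hz2.1 hz2.2) (Real.exp_pos (-(Ca * z))).le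
  refine le_trans (le_of_eq ?_) (add_le_add h1 le_rfl)
  have hzt : z - t ≠ 0 := by linarith [hz2.1]
  simp only [slope_def_field, Ph]
  field_simp
  ring

lemma Ctx.all_OO (H : Ctx a U Λ M τ T R Ca) (hM : 0 ≤ M) (hΛ : 0 ≤ Λ) :
    Icc τ T ⊆ OO a U τ T R Ca := by
  by_contra hcon
  set P := Icc τ T \ OO a U τ T R Ca with hP
  have hPc : IsClosed P := isClosed_Icc.sdiff isOpen_OO
  have hPne : P.Nonempty := by
    obtain ⟨y, hy1, hy2⟩ := not_subset.mp hcon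
    exact ⟨y, hy1, hy2⟩
  have hPsub : P ⊆ Icc τ T := sdiff_subset
  have : Nonempty P := hPne.to_subtype
  have : CompleteSpace P := hPc.completeSpace_coe
  obtain ⟨k, hk⟩ := nonempty_interior_of_iUnion_of_closed
    (f := fun k : ℕ => {s : P | (s : ℝ) ∈ TK U R k})
    (fun k => H.TK_closed hPsub k) (by
      ext s
      simp only [mem_iUnion, mem_univ, iff_true]
      exact H.TK_cover (H.hτ.trans_le (hPsub s.2).1))
  obtain ⟨⟨t0, ht0⟩, hint⟩ := hk
  obtain ⟨δ, hδ, hball⟩ := Metric.mem_nhds_iff.mp (mem_interior_iff_mem_nhds.mp hint)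
  have hport : ∀ s ∈ P, s ∈ Ioo (t0 - δ) (t0 + δ) → s ∈ TK U R k := by
    intro s hs hsI
    have : (⟨s, hs⟩ : P) ∈ ball (⟨t0, ht0⟩ : P) δ := by
      rw [Metric.mem_ball, Subtype.dist_eq, Real.dist_eq, abs_lt]
      exact ⟨by linarith [hsI.1], by linarith [hsI.2]⟩
    exact hball this
  refine ht0.2 ⟨δ, hδ, fun α hα w hw => ?_⟩
  intro s hs s' hs' hss'
  have hanti : AntitoneOn (Ph Ca U w) (Icc s s') := by
    refine antitone_of_slope ((H.Ph_cont hα.1 hw).mono (Icc_subset_Icc hs.2.1 hs'.2.2)) ?_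
    intro x hx r hr
    have hxα : α ≤ x := hs.2.1.trans hx.1.le
    have hxT : x ≤ T := hx.2.le.trans hs'.2.2
    have hxI : x ∈ Icc τ T := ⟨hα.1.trans hxα, hxT⟩
    by_cases hxP : x ∈ OO a U τ T R Ca
    · exact slope_of_mem_OO hxP hα hw hxα hx.2 hs'.2.2 hr
    have hxP' : x ∈ P := ⟨hxI, hxP⟩
    by_cases hacc : ∃ᶠ z in nhdsWithin x (Ioi x), z ∈ P ∩ Iio s'
    · refine H.acc_slope hα.1 hw ⟨hxα, hxT⟩ hacc (fun z hz => hz.1.1.2) (fun R' hR' => ?_) hr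
      obtain ⟨B, hB0, hB⟩ := H.lip hM hΛ (k := k) (Nat.cast_nonneg k) hR'
      refine ⟨B, hB0, fun z hz hxz y hy => hB x z hxz.le hxP' hz.1 ?_ y hy⟩
      rintro y ⟨hy1, hy2⟩
      exact hport y hy2 ⟨by linarith [hs.1.1, hx.1, hy1.1],
        by linarith [hs'.1.2, hy1.2, mem_Iio.mp hz.2]⟩
    · rw [not_frequently] at hacc
      obtain ⟨e, he, hes⟩ := (mem_nhdsGT_iff_exists_Ioo_subset (a := x)).mp hacc
      have hO : Ioo x (min e s') ⊆ OO a U τ T R Ca := by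
        intro y hy
        have h1 := lt_min_iff.mp hy.2
        have h2 := hes ⟨hy.1, h1.1⟩
        by_contra hc
        exact h2 ⟨⟨⟨hxI.1.trans hy.1.le, h1.2.le.trans hs'.2.2⟩, hc⟩, h1.2⟩
      exact slope_nonpos_of_antitone (lt_min he hx.2)
        (H.gap hα hw hxα ((min_le_right _ _).trans hs'.2.2) hO) hr
  exact hanti (left_mem_Icc.mpr hss') (right_mem_Icc.mpr hss') hss'

/-- Comparison principle. -/
lemma Ctx.compare (H : Ctx a U Λ M τ T R Ca) (hM : 0 ≤ M) (hΛ : 0 ≤ Λ) (hτT : τ ≤ T)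
    (hw : Adm a T R τ w) (h0 : ∀ x, U (x, τ) ≤ w (x, τ)) (x : E n) : U (x, T) ≤ w (x, T) :=
  H.le_of_antitone (left_mem_Icc.mpr hτT) hw le_rfl le_rfl hτT
    (H.gap (left_mem_Icc.mpr hτT) hw le_rfl le_rfl
      (Ioo_subset_Icc_self.trans (H.all_OO hM hΛ))) h0 x

end

section
variable {n : ℕ}

lemma slice_fderiv {f : E n × ℝ → ℝ} {x : E n} {t : ℝ} (hf : DifferentiableAt ℝ f (x, t))
    (v : E n) : fderiv ℝ (fun y => f (y, t)) x v = fderiv ℝ f (x, t) (v, 0) := by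
  have h1 : HasFDerivAt (fun y : E n => (y, t)) (ContinuousLinearMap.inl ℝ (E n) ℝ) x :=
    hasFDerivAt_prodMk_left x t
  have h2 := hf.hasFDerivAt.comp x h1
  have h3 : HasFDerivAt (fun y => f (y, t)) _ x := h2
  rw [h3.fderiv]
  simp

lemma isOpen_half : IsOpen ((univ : Set (E n)) ×ˢ Ioi (0 : ℝ)) := isOpen_univ.prod isOpen_Ioi

lemma d2_joint {f : E n × ℝ → ℝ} (hf : ContDiffOn ℝ 2 f (univ ×ˢ Ioi (0 : ℝ))) (i j : Fin n)
    {x : E n} {t : ℝ} (ht : 0 < t) :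
    d2 (fun y => f (y, t)) x i j =
      fderiv ℝ (fun Y => fderiv ℝ f Y (EuclideanSpace.single j 1, 0)) (x, t)
        (EuclideanSpace.single i 1, 0) := by
  have hmem : ∀ y : E n, (univ ×ˢ Ioi (0 : ℝ)) ∈ nhds (y, t) := fun y =>
    isOpen_half.mem_nhds ⟨mem_univ _, ht⟩
  unfold d2
  have e : (fun y => fderiv ℝ (fun y => f (y, t)) y (EuclideanSpace.single j 1)) =
      fun y => (fun Y => fderiv ℝ f Y (EuclideanSpace.single j 1, 0)) (y, t) := by
    funext y
    exact slice_fderiv ((hf.contDiffAt (hmem y)).differentiableAt (by norm_num)) _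
  rw [e]
  refine slice_fderiv (f := fun Y => fderiv ℝ f Y (EuclideanSpace.single j 1, 0)) ?_ _
  have h1 : ContDiffOn ℝ 1 (fderiv ℝ f) (univ ×ˢ Ioi (0 : ℝ)) :=
    hf.fderiv_of_isOpen isOpen_half (by norm_num)
  exact ((h1.contDiffAt (hmem x)).differentiableAt (by norm_num)).clm_apply
    (differentiableAt_const _)

lemma d2_joint_cont {f : E n × ℝ → ℝ} (hf : ContDiffOn ℝ 2 f (univ ×ˢ Ioi (0 : ℝ)))
    (i j : Fin n) :
    ContinuousOn (fun X : E n × ℝ => d2 (fun y => f (y, X.2)) X.1 i j)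
      (univ ×ˢ Ioi (0 : ℝ)) := by
  have h1 : ContDiffOn ℝ 1 (fderiv ℝ f) (univ ×ˢ Ioi (0 : ℝ)) :=
    hf.fderiv_of_isOpen isOpen_half (by norm_num)
  have h2 : ContDiffOn ℝ 1 (fun Y => fderiv ℝ f Y (EuclideanSpace.single j 1, 0))
    (univ ×ˢ Ioi (0 : ℝ)) := h1.clm_apply contDiffOn_const
  have h3 : ContinuousOn (fun X => fderiv ℝ (fun Y => fderiv ℝ f Y (EuclideanSpace.single j 1, 0)) X
      (EuclideanSpace.single i 1, 0)) (univ ×ˢ Ioi (0 : ℝ)) :=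
    (h2.continuousOn_fderiv_of_isOpen isOpen_half (by norm_num)).clm_apply continuousOn_const
  refine h3.congr fun X hX => ?_
  exact d2_joint hf i j hX.2

lemma exists_Ca {a : E n × ℝ → Fin n → Fin n → ℝ}
    (ha : ∀ i j, ContDiffOn ℝ 2 (fun X => a X i j) (univ ×ˢ Ioi (0 : ℝ))) {τ : ℝ} (hτ : 0 < τ)
    (T R : ℝ) : ∃ Ca, ∀ t ∈ Icc τ T, ∀ x, ‖x‖ ≤ R →
      ∑ i, ∑ j, d2 (fun y => a (y, t) i j) x j i ≤ Ca := by
  have hc : IsCompact ((closedBall (0 : E n) R) ×ˢ Icc τ T) :=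
    (isCompact_closedBall _ _).prod isCompact_Icc
  have hco : ContinuousOn
      (fun X : E n × ℝ => ∑ i, ∑ j, d2 (fun y => a (y, X.2) i j) X.1 j i)
      ((closedBall (0 : E n) R) ×ˢ Icc τ T) := by
    refine continuousOn_finsetSum _ fun i _ => continuousOn_finsetSum _ fun j _ => ?_
    exact (d2_joint_cont (ha i j) j i).mono
      (prod_mono (subset_univ _) fun t ht => hτ.trans_le ht.1)
  obtain ⟨C, hC⟩ := hc.exists_bound_of_continuousOn hco
  refine ⟨C, fun t ht x hx => ?_⟩
  exact (le_abs_self _).trans (hC (x, t) ⟨by simpa using hx, ht⟩)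

/-- The explicit barrier. -/
def bw (K m ε : ℝ) (X : E n × ℝ) : ℝ :=
  ε - Real.exp (-(m * X.2)) * (1 / 2 + 2 * K ^ 2 * X.2 - ‖X.1‖ ^ 2) ^ 3

lemma bw_contDiff (K m ε : ℝ) : ContDiff ℝ 2 (bw (n := n) K m ε) := by
  unfold bw
  have h1 : ContDiff ℝ 2 (fun X : E n × ℝ => ‖X.1‖ ^ 2) := contDiff_fst.norm_sq ℝ
  have h2 : ContDiff ℝ 2 (fun X : E n × ℝ => X.2) := contDiff_snd
  refine contDiff_const.sub (ContDiff.mul ?_ (ContDiff.pow ?_ 3))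
  · exact ((contDiff_const.mul h2).neg).exp
  · exact (contDiff_const.add (contDiff_const.mul h2)).sub h1

lemma hasFDerivAt_W (g : ℝ) (y : E n) :
    HasFDerivAt (fun z : E n => g - ‖z‖ ^ 2) (-(2 • (innerSL ℝ y))) y := by
  have := (hasFDerivAt_nsq 0 y).const_sub g
  simpa using this

lemma bw_d2 (K m ε : ℝ) (x : E n) (t : ℝ) (i j : Fin n) :
    D2 (bw K m ε) (x, t) i j = 6 * Real.exp (-(m * t)) *
      ((1 / 2 + 2 * K ^ 2 * t - ‖x‖ ^ 2) ^ 2 * (if i = j then 1 else 0) -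
        4 * (1 / 2 + 2 * K ^ 2 * t - ‖x‖ ^ 2) * (x i * x j)) := by
  unfold D2
  simp only [bw]
  set g := 1 / 2 + 2 * K ^ 2 * t
  set c := Real.exp (-(m * t))
  have h1 : (fun y : E n => fderiv ℝ (fun x' : E n => ε - c * (g - ‖x'‖ ^ 2) ^ 3) y
      (EuclideanSpace.single j 1)) = fun y => (6 * c * (g - ‖y‖ ^ 2) ^ 2) * y j := by
    funext y
    have h2 := ((((hasDerivAt_pow 3 (g - ‖y‖ ^ 2)).comp_hasFDerivAt y
      (hasFDerivAt_W g y)).const_mul c).const_sub ε)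
    have h4 : HasFDerivAt (fun x' : E n => ε - c * (g - ‖x'‖ ^ 2) ^ 3) _ y := h2
    rw [h4.fderiv]
    simp [EuclideanSpace.inner_single_right]
    ring
  rw [h1]
  have h5 := ((((hasDerivAt_pow 2 (g - ‖x‖ ^ 2)).comp_hasFDerivAt x
      (hasFDerivAt_W g x)).const_mul (6 * c))).mul
        ((EuclideanSpace.proj (𝕜 := ℝ) j : E n →L[ℝ] ℝ).hasFDerivAt (x := x))
  have h6 : HasFDerivAt (fun y : E n => (6 * c * (g - ‖y‖ ^ 2) ^ 2) * y j) _ x := h5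
  rw [h6.fderiv]
  simp [EuclideanSpace.inner_single_right, Pi.single_apply]
  by_cases hij : i = j
  · simp [hij]; ring
  · simp [hij, Ne.symm hij]; ring

lemma bw_dt (K m ε : ℝ) (x : E n) (t : ℝ) :
    Dt (bw K m ε) (x, t) = Real.exp (-(m * t)) *
      (m * (1 / 2 + 2 * K ^ 2 * t - ‖x‖ ^ 2) ^ 3 -
        6 * K ^ 2 * (1 / 2 + 2 * K ^ 2 * t - ‖x‖ ^ 2) ^ 2) := by
  unfold Dt
  simp only [bw]
  have h1 : HasDerivAt (fun s : ℝ => Real.exp (-(m * s))) (Real.exp (-(m * t)) * (-m)) t := by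
    have := (((hasDerivAt_id t).const_mul m).neg).exp
    simpa using this
  have h2 : HasDerivAt (fun s : ℝ => 1 / 2 + 2 * K ^ 2 * s - ‖x‖ ^ 2) (2 * K ^ 2) t := by
    have := (((hasDerivAt_id t).const_mul (2 * K ^ 2)).const_add (1 / 2)).sub_const (‖x‖ ^ 2)
    simpa using this
  have h3 := ((h1.mul (h2.pow 3)).const_sub ε)
  have h4 : HasDerivAt (fun s : ℝ => ε - Real.exp (-(m * s)) *
    (1 / 2 + 2 * K ^ 2 * s - ‖x‖ ^ 2) ^ 3) _ t := h3
  rw [h4.deriv]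
  simp
  ring

lemma bw_LVal {a : E n × ℝ → Fin n → Fin n → ℝ} {ν K m ε t : ℝ} {x : E n} (hν : 0 < ν)
    (ht : 0 ≤ t)
    (hell : ∀ ξ : Fin n → ℝ, ν * ∑ i, ξ i ^ 2 ≤ ∑ i, ∑ j, a (x, t) i j * ξ i * ξ j)
    (hb : ∀ i j, |a (x, t) i j| ≤ ν⁻¹)
    (hm : (24 * ν + 6 * (n * ν⁻¹) + 6 * K ^ 2) ^ 2 ≤ 48 * ν * m)
    (hW : 0 < 1 / 2 + 2 * K ^ 2 * t - ‖x‖ ^ 2) : LVal a (bw K m ε) (x, t) ≤ 0 := by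
  unfold LVal
  rw [bw_dt]
  simp only [bw_d2]
  set W := 1 / 2 + 2 * K ^ 2 * t - ‖x‖ ^ 2 with hWd
  set c := Real.exp (-(m * t))
  have hc : 0 < c := Real.exp_pos _
  have e1 : ∑ i, ∑ j, a (x, t) i j * (6 * c * (W ^ 2 * (if i = j then 1 else 0) -
      4 * W * (x i * x j))) = 6 * c * W ^ 2 * (∑ i, a (x, t) i i) -
      24 * c * W * ∑ i, ∑ j, a (x, t) i j * x i * x j := by
    rw [Finset.mul_sum, Finset.mul_sum, ← Finset.sum_sub_distrib]
    refine Finset.sum_congr rfl fun i _ => ?_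
    have : 6 * c * W ^ 2 * a (x, t) i i =
        ∑ j, 6 * c * W ^ 2 * a (x, t) i j * (if i = j then 1 else 0) := by
      simp
    rw [this, Finset.mul_sum, ← Finset.sum_sub_distrib]
    exact Finset.sum_congr rfl fun j _ => by ring
  rw [e1]
  have htr : ∑ i, a (x, t) i i ≤ n * ν⁻¹ := by
    refine (Finset.sum_le_sum fun i _ => (le_abs_self _).trans (hb i i)).trans_eq ?_
    simp
  have hx := hell (fun i => x i)
  have hx2 : ∑ i, x i ^ 2 = ‖x‖ ^ 2 := by rw [EuclideanSpace.norm_sq_eq]; simp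
  rw [hx2] at hx
  set S := ∑ i, ∑ j, a (x, t) i j * x i * x j
  set tr := ∑ i, a (x, t) i i
  have hg : 1 / 2 - W ≤ ‖x‖ ^ 2 := by
    have : 0 ≤ 2 * K ^ 2 * t := by positivity
    rw [hWd]; linarith
  have hS : ν * (1 / 2 - W) ≤ S := (mul_le_mul_of_nonneg_left hg hν.le).trans hx
  set D := 24 * ν + 6 * (n * ν⁻¹) + 6 * K ^ 2 with hD
  have hq : 0 ≤ 12 * ν - D * W + m * W ^ 2 := by
    have h1 : 0 ≤ 48 * ν * (12 * ν - D * W + m * W ^ 2) := by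
      nlinarith [sq_nonneg (24 * ν - D * W), mul_le_mul_of_nonneg_right hm (sq_nonneg W)]
    exact nonneg_of_mul_nonneg_right h1 (by positivity)
  have h1 : 24 * W * (ν * (1 / 2 - W)) ≤ 24 * W * S := by gcongr
  have h2 : 6 * W ^ 2 * tr ≤ 6 * W ^ 2 * (n * ν⁻¹) := by gcongr
  have h3 : 0 ≤ W * (12 * ν - D * W + m * W ^ 2) := mul_nonneg hW.le hq
  have h4 : 6 * W ^ 2 * tr - 24 * W * S - (m * W ^ 3 - 6 * K ^ 2 * W ^ 2) ≤ 0 := by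
    rw [hD] at h3
    nlinarith
  have h5 := mul_nonpos_of_nonneg_of_nonpos hc.le h4
  nlinarith

end

section
variable {n : ℕ}

/-- The boundary datum. -/
def bphi (X : E n × ℝ) : ℝ := (max (1 / 2 - ‖X.1‖ ^ 2) 0) ^ 3

lemma bphi_cont : Continuous (bphi (n := n)) := by unfold bphi; fun_prop

lemma bphi_nonneg (X : E n × ℝ) : 0 ≤ bphi X := pow_nonneg (le_max_right _ _) 3

lemma bphi_le (X : E n × ℝ) : bphi X ≤ 1 := by
  refine pow_le_one₀ (le_max_right _ _) (max_le ?_ zero_le_one)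
  nlinarith [sq_nonneg ‖X.1‖]

lemma main_compare {ν K m : ℝ} (hν : 0 < ν)
    (hm : (24 * ν + 6 * (n * ν⁻¹) + 6 * K ^ 2) ^ 2 ≤ 48 * ν * m)
    {a : E n × ℝ → Fin n → Fin n → ℝ}
    (ha : IsParabolicCoeff ν a (closure (Cyl (univ : Set (E n)))))
    {ω : E n × ℝ → Measure (E n × ℝ)} (hω : IsCaloricMeasure a univ ω)
    (x0 : E n) {t0 : ℝ} (ht0 : 0 < t0) :
    Real.exp (-(m * t0)) * (1 / 2 + 2 * K ^ 2 * t0 - ‖x0‖ ^ 2) ^ 3 ≤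
      ∫ z, bphi z ∂ω (x0, t0) := by
  refine le_of_forall_pos_le_add fun ε hε => ?_
  set U : E n × ℝ → ℝ := fun X => ∫ z, -bphi z ∂ω X with hU
  have hcyl : CylFrom (univ : Set (E n)) 0 = univ ×ˢ Ioi 0 := rfl
  have hmemC : ∀ (x : E n) (t : ℝ), 0 < t → (x, t) ∈ CylFrom (univ : Set (E n)) 0 :=
    fun x t ht => ⟨mem_univ _, ht⟩
  have hsub : (univ : Set (E n)) ×ˢ Ioi (0 : ℝ) ⊆ closure (Cyl (univ : Set (E n))) :=
    subset_closure
  have haC : ∀ i j, ContDiffOn ℝ 2 (fun X => a X i j) (univ ×ˢ Ioi (0 : ℝ)) := fun i j =>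
    contDiffOn_infty.mp ((ha.1 i j).mono hsub) 2
  have haB : ∀ (x : E n) (t : ℝ), 0 < t →
      (∀ ξ : Fin n → ℝ, ν * ∑ i, ξ i ^ 2 ≤ ∑ i, ∑ j, a (x, t) i j * ξ i * ξ j) ∧
      ∀ i j, |a (x, t) i j| ≤ ν⁻¹ := fun x t ht => ha.2 _ (hsub ⟨mem_univ _, ht⟩)
  obtain ⟨hsol, hbdry⟩ := hω.2 (fun z => -bphi z) bphi_cont.neg
    ⟨1, fun z => by
      show |-bphi z| ≤ 1
      rw [abs_neg, abs_of_nonneg (bphi_nonneg z)]; exact bphi_le z⟩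
  have hint : ∀ (x : E n) (t : ℝ), 0 < t → Integrable (fun z => -bphi z) (ω (x, t)) := by
    intro x t ht
    have := (hω.1 (x, t) (hmemC x t ht)).1
    refine Integrable.of_bound bphi_cont.neg.aestronglyMeasurable 1
      (Eventually.of_forall fun z => ?_)
    rw [Real.norm_eq_abs, abs_neg, abs_of_nonneg (bphi_nonneg z)]
    exact bphi_le z
  have hU0 : ∀ (x : E n) (t : ℝ), 0 < t → U (x, t) ≤ 0 := fun x t ht =>
    integral_nonpos fun z => by
      show -bphi z ≤ 0
      linarith [bphi_nonneg z]
  have hUM : ∀ (x : E n) (t : ℝ), 0 < t → -1 ≤ U (x, t) := by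
    intro x t ht
    have := (hω.1 (x, t) (hmemC x t ht)).1
    have h1 := integral_mono (μ := ω (x, t)) (integrable_const (-1 : ℝ)) (hint x t ht)
      (fun z => by show (-1 : ℝ) ≤ -bphi z; linarith [bphi_le z])
    simpa using h1
  set R' := 1 / 2 + 2 * K ^ 2 * t0 + 1 with hR'
  set w : E n × ℝ → ℝ := bw K m ε with hwdef
  have hwval : ∀ x t, w (x, t) =
    ε - Real.exp (-(m * t)) * (1 / 2 + 2 * K ^ 2 * t - ‖x‖ ^ 2) ^ 3 := fun x t => rfl
  have hWneg : ∀ t, t ≤ t0 → ∀ x : E n, R' < ‖x‖ → 1 / 2 + 2 * K ^ 2 * t - ‖x‖ ^ 2 ≤ 0 := by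
    intro t ht x hx
    have h1 : K ^ 2 * t ≤ K ^ 2 * t0 := by gcongr
    have h2 : 0 ≤ K ^ 2 * t0 := by positivity
    rw [hR'] at hx
    nlinarith
  have hwpos : ∀ (t : ℝ) (x : E n), 1 / 2 + 2 * K ^ 2 * t - ‖x‖ ^ 2 ≤ 0 → ε ≤ w (x, t) := by
    intro t x h
    rw [hwval]
    have h1 : (1 / 2 + 2 * K ^ 2 * t - ‖x‖ ^ 2) ^ 3 ≤ 0 := by
      rw [show (3 : ℕ) = 2 + 1 from rfl, pow_succ]
      exact mul_nonpos_of_nonneg_of_nonpos (sq_nonneg _) h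
    have := mul_nonpos_of_nonneg_of_nonpos (Real.exp_pos (-(m * t))).le h1
    linarith
  have hev : ∀ᶠ s in nhds (0 : ℝ), ∀ z ∈ closedBall (0 : E n) R',
      0 < s → U (z, s) - w (z, s) < 0 := by
    refine (isCompact_closedBall (0 : E n) R').eventually_forall_of_forall_eventually
      (P := fun (s : ℝ) (z : E n) => 0 < s → U (z, s) - w (z, s) < 0) fun z hz => ?_
    have h1 : Tendsto U (nhdsWithin (z, (0 : ℝ)) (CylFrom (univ : Set (E n)) 0))
        (nhds (-bphi (z, (0 : ℝ)))) := by
      refine hbdry (z, 0) (Or.inr ⟨by simp, rfl⟩)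
    have h2 : Tendsto w (nhdsWithin (z, (0 : ℝ)) (CylFrom (univ : Set (E n)) 0))
        (nhds (w (z, 0))) :=
      (bw_contDiff K m ε).continuous.continuousWithinAt
    have h3 : -bphi (z, (0 : ℝ)) - w (z, 0) < 0 := by
      rw [hwval]
      have : (1 / 2 - ‖z‖ ^ 2) ^ 3 ≤ (max (1 / 2 - ‖z‖ ^ 2) 0) ^ 3 := by
        rcases le_total (1 / 2 - ‖z‖ ^ 2) 0 with h | h
        · rw [max_eq_right h, show (3 : ℕ) = 2 + 1 from rfl, pow_succ, pow_succ _ 2]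
          simpa using mul_nonpos_of_nonneg_of_nonpos (sq_nonneg _) h
        · rw [max_eq_left h]
      simp only [bphi, mul_zero, neg_zero, Real.exp_zero, add_zero, one_mul]
      linarith
    have h4 := (h1.sub h2).eventually_lt_const h3
    rw [eventually_nhdsWithin_iff] at h4
    have h5 : Tendsto (Prod.swap : ℝ × E n → E n × ℝ) (nhds ((0 : ℝ), z)) (nhds (z, (0 : ℝ))) :=
      continuous_swap.tendsto _
    filter_upwards [h5.eventually h4] with y hy hy0
    exact hy ⟨mem_univ _, hy0⟩
  have hex : ∃ τ : ℝ, 0 < τ ∧ τ < t0 ∧ ∀ z ∈ closedBall (0 : E n) R',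
      0 < τ → U (z, τ) - w (z, τ) < 0 := by
    have h1 : ∀ᶠ s in nhdsWithin (0 : ℝ) (Ioi 0), s ∈ Ioo (0 : ℝ) t0 := Ioo_mem_nhdsGT ht0
    obtain ⟨τ, h2, h3⟩ := (h1.and (hev.filter_mono nhdsWithin_le_nhds)).exists
    exact ⟨τ, h2.1, h2.2, h3⟩
  obtain ⟨τ, hτ, hτt, hτw⟩ := hex
  obtain ⟨Ca, hCa⟩ := exists_Ca haC hτ t0 (R' + 1)
  have H : Ctx a U ν⁻¹ 1 τ t0 (R' + 1) Ca :=
    { hτ := hτ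
      hM := hUM
      hU0 := hU0
      hx := fun t ht => contDiff_iff_contDiffAt.mpr fun x => (hsol.1 (x, t) (hmemC x t ht)).1
      ht := fun x t ht => (hsol.1 (x, t) (hmemC x t ht)).2
      hL := fun x t ht => hsol.2 (x, t) (hmemC x t ht)
      ha2 := fun t ht i j => contDiff_iff_contDiffAt.mpr fun x =>
        ((haC i j).contDiffAt (isOpen_half.mem_nhds (show (x, t) ∈ univ ×ˢ Ioi (0 : ℝ) from ⟨mem_univ x, ht⟩))).comp x
          (contDiffAt_id.prodMk contDiffAt_const)
      hpsd := fun x t ht ξ => le_trans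
        (mul_nonneg hν.le (Finset.sum_nonneg fun i _ => sq_nonneg _)) ((haB x t ht).1 ξ)
      hΛ := fun x t ht => (haB x t ht).2
      hCa := hCa }
  have hadm : Adm a t0 (R' + 1) τ w := by
    refine ⟨bw_contDiff K m ε, R', by linarith, fun t ht x hx => ?_⟩
    have hW : 0 < 1 / 2 + 2 * K ^ 2 * t - ‖x‖ ^ 2 := by
      by_contra hc
      linarith [hwpos t x (not_lt.mp hc)]
    have ht' : 0 < t := hτ.trans_le ht.1
    refine ⟨?_, bw_LVal hν ht'.le (haB x t ht').1 (haB x t ht').2 hm hW⟩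
    by_contra hc
    linarith [hWneg t ht.2 x (not_le.mp hc)]
  have hfin := H.compare zero_le_one (inv_pos.mpr hν).le hτt.le hadm (fun x => ?_) x0
  · rw [hwval] at hfin
    have : U (x0, t0) = -∫ z, bphi z ∂ω (x0, t0) := integral_neg _
    linarith
  · rcases le_or_gt ‖x‖ R' with h | h
    · linarith [hτw x (by simpa using h) hτ]
    · linarith [hU0 x τ hτ, hwpos τ x (hWneg τ hτt.le x h)]

lemma bphi_measure {a : E n × ℝ → Fin n → Fin n → ℝ}
    {ω : E n × ℝ → Measure (E n × ℝ)} (hω : IsCaloricMeasure a univ ω)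
    (x : E n) {t : ℝ} (ht : 0 < t) :
    ENNReal.ofReal (∫ z, bphi z ∂ω (x, t)) ≤ ω (x, t) (ball (0 : E n) 1 ×ˢ {(0 : ℝ)}) := by
  obtain ⟨hp, h0⟩ := hω.1 (x, t) ⟨mem_univ _, ht⟩
  set S := ball (0 : E n) 1 ×ˢ {(0 : ℝ)} with hS
  have hSm : MeasurableSet S := measurableSet_ball.prod (measurableSet_singleton _)
  have hae : ∀ᵐ z ∂ω (x, t), bphi z ≤ S.indicator (fun _ => (1 : ℝ)) z := by
    have h1 : ∀ᵐ z ∂ω (x, t), z ∈ pBFrom (univ : Set (E n)) 0 := by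
      rw [ae_iff]; exact h0
    filter_upwards [h1] with z hz
    have hz2 : z.2 = 0 := by
      rcases hz with h | h
      · simp at h
      · exact h.2
    by_cases hzS : z ∈ S
    · rw [indicator_of_mem hzS]; exact bphi_le z
    · rw [indicator_of_notMem hzS]
      have h3 : 1 ≤ ‖z.1‖ := by
        by_contra hc
        exact hzS ⟨by simpa using hc, hz2⟩
      unfold bphi
      rw [max_eq_right (by nlinarith)]
      norm_num
  have hle : ∫ z, bphi z ∂ω (x, t) ≤ (ω (x, t)).real S := by
    rw [← integral_indicator_one hSm]
    refine integral_mono_ae ?_ ?_ hae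
    · refine Integrable.of_bound bphi_cont.aestronglyMeasurable 1
        (Eventually.of_forall fun z => ?_)
      rw [Real.norm_eq_abs, abs_of_nonneg (bphi_nonneg z)]
      exact bphi_le z
    · exact (integrable_const (1 : ℝ)).indicator hSm
  calc ENNReal.ofReal (∫ z, bphi z ∂ω (x, t)) ≤ ENNReal.ofReal ((ω (x, t)).real S) :=
        ENNReal.ofReal_le_ofReal hle
    _ = ω (x, t) S := ENNReal.ofReal_toReal (measure_ne_top _ _)

end

/-- **Estimate (4.8)**: for `Q = ℝⁿ × (0,∞)`, every `K ≥ 1` and `R > 0`, there is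
`N = N(n, ν, K, R)` such that `ω^X(B₁(0) × {0}) ≥ 1/N` for all
`X ∈ U_R = {(x,t) : t > 0, |x| ≤ K√t ≤ KR}`. -/
theorem caloric_measure_paraboloid_lower_bound (n : ℕ) (hn : 1 ≤ n) (ν : ℝ)
    (hν : ν ∈ Ioc (0 : ℝ) 1) (K R : ℝ) (hK : 1 ≤ K) (hR : 0 < R) :
    ∃ N : ℝ, 0 < N ∧
      ∀ (a : E n × ℝ → Fin n → Fin n → ℝ),
        IsParabolicCoeff ν a (closure (Cyl (univ : Set (E n)))) →
      ∀ ω : E n × ℝ → Measure (E n × ℝ), IsCaloricMeasure a univ ω →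
      ∀ (x : E n) (t : ℝ), 0 < t → ‖x‖ ≤ K * Real.sqrt t →
        K * Real.sqrt t ≤ K * R →
        ENNReal.ofReal (1 / N) ≤ ω (x, t) (ball (0 : E n) 1 ×ˢ {(0 : ℝ)}) := by

  have hν0 : 0 < ν := hν.1
  set m := (24 * ν + 6 * (n * ν⁻¹) + 6 * K ^ 2) ^ 2 / (48 * ν) with hm
  have hm0 : 0 ≤ m := by positivity
  have hm1 : (24 * ν + 6 * (n * ν⁻¹) + 6 * K ^ 2) ^ 2 ≤ 48 * ν * m := by
    rw [hm, mul_div_cancel₀ _ (by positivity)]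
  refine ⟨8 * Real.exp (m * R ^ 2), by positivity, fun a ha ω hω x t ht hx htR => ?_⟩
  refine le_trans (ENNReal.ofReal_le_ofReal ?_) (bphi_measure hω x ht)
  refine le_trans ?_ (main_compare (K := K) hν0 hm1 ha hω x ht)
  have hsq : Real.sqrt t ^ 2 = t := Real.sq_sqrt ht.le
  have hx2 : ‖x‖ ^ 2 ≤ K ^ 2 * t := by
    have := pow_le_pow_left₀ (norm_nonneg x) hx 2
    rwa [mul_pow, hsq] at this
  have htR' : t ≤ R ^ 2 := by
    have h1 : Real.sqrt t ≤ R := le_of_mul_le_mul_left htR (by linarith)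
    have := pow_le_pow_left₀ (Real.sqrt_nonneg t) h1 2
    rwa [hsq] at this
  have hKt : 0 ≤ K ^ 2 * t := by positivity
  have hW : 1 / 2 ≤ 1 / 2 + 2 * K ^ 2 * t - ‖x‖ ^ 2 := by linarith
  have hW3 : (1 / 2 : ℝ) ^ 3 ≤ (1 / 2 + 2 * K ^ 2 * t - ‖x‖ ^ 2) ^ 3 :=
    pow_le_pow_left₀ (by norm_num) hW 3
  have hexp : Real.exp (-(m * R ^ 2)) ≤ Real.exp (-(m * t)) := by
    apply Real.exp_le_exp.mpr
    have : m * t ≤ m * R ^ 2 := by gcongr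
    linarith
  calc 1 / (8 * Real.exp (m * R ^ 2)) = Real.exp (-(m * R ^ 2)) * (1 / 2 : ℝ) ^ 3 := by
        rw [Real.exp_neg]; field_simp; norm_num
    _ ≤ _ := mul_le_mul hexp hW3 (by norm_num) (Real.exp_pos _).le
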